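/- Let C = C(χ_r, P) be an (r,P)-shadow code of length n = q with P = {p_1,...,p_L}. If deg p_i < (q(r-1)-1)/(rL√q) for all i ∈ {1,...,L}, then the evaluation map ev : F_r^L → F_r^q is injective, and hence the dimension of C as an F_r-vector space equals L. -/

import Mathlib

/-- The shadow-code evaluation map. -/
noncomputable def shadowEv {F : Type} [Field F] [Fintype F] {r L : ℕ}
    (χ : Fˣ →* (rootsOfUnity r ℂ)) (φ : (rootsOfUnity r ℂ) → ZMod r)
    (p : Fin L → Polynomial F) (hnz : ∀ i (x : F), (p i).eval x ≠ 0) :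
    (Fin L → ZMod r) → (F → ZMod r) :=
  fun v x => φ (χ (∏ i, (Units.mk0 ((p i).eval x) (hnz i x)) ^ (v i).val))


open Polynomial in
lemma sc_T_exists {E : Type*} [Field E] (f : E[X]) (D : ℕ) (hD : f.natDegree ≤ D) (e : ℕ) :
    ∀ l : ℕ, ∃ T : E[X], f ^ l * hasseDeriv l (f ^ e) = f ^ e * T ∧ T.natDegree ≤ l * D := by
  induction e with
  | zero =>
    intro l
    rcases Nat.eq_zero_or_pos l with rfl | hl
    · exact ⟨1, by simp, by simp⟩
    · refine ⟨0, ?_, by simp⟩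
      have := hasseDeriv_C (R := E) l 1 hl
      simp only [map_one] at this
      simp [this]
  | succ e ih =>
    intro l
    choose T hT hTd using ih
    have h1 : ∀ j : ℕ, ∃ S : E[X], f ^ j * hasseDeriv j f = f * S ∧ S.natDegree ≤ j * D := by
      intro j
      rcases Nat.eq_zero_or_pos j with rfl | hj
      · exact ⟨1, by simp, by simp⟩
      · obtain ⟨k, rfl⟩ : ∃ k, j = k + 1 := ⟨j - 1, by omega⟩
        refine ⟨f ^ k * hasseDeriv (k + 1) f, by ring, ?_⟩
        refine natDegree_mul_le.trans ?_
        have a1 := natDegree_pow_le (p := f) (n := k)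
        have a2 := natDegree_hasseDeriv_le f (k + 1)
        have a3 : k * f.natDegree ≤ k * D := Nat.mul_le_mul_left _ hD
        have a4 : (k + 1) * D = k * D + D := by ring
        omega
    choose S hS hSd using h1
    refine ⟨∑ ij ∈ Finset.HasAntidiagonal.antidiagonal l, T ij.1 * S ij.2, ?_, ?_⟩
    · rw [pow_succ, hasseDeriv_mul, Finset.mul_sum, Finset.mul_sum]
      refine Finset.sum_congr rfl fun ij hij => ?_
      have : ij.1 + ij.2 = l := by simpa using hij
      rw [← this, pow_add]
      calc _ = (f ^ ij.1 * hasseDeriv ij.1 (f ^ e)) * (f ^ ij.2 * hasseDeriv ij.2 f) := by ring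
        _ = _ := by rw [hT, hS]; ring
    · refine natDegree_sum_le_of_forall_le _ _ fun ij hij => ?_
      have : ij.1 + ij.2 = l := by simpa using hij
      refine natDegree_mul_le.trans ?_
      have := hTd ij.1
      have := hSd ij.2
      have : l * D = ij.1 * D + ij.2 * D := by rw [← add_mul]; congr; omega
      omega

open Polynomial in
lemma sc_U_exists {E : Type*} [Field E] (f : E[X]) (D : ℕ) (hD : f.natDegree ≤ D) (e l : ℕ) :
    ∃ U : E[X] →ₗ[E] E[X], ∀ a, f ^ l * hasseDeriv l (a * f ^ e) = f ^ e * U a ∧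
      (U a).natDegree ≤ a.natDegree + l * D := by
  choose T hT hTd using sc_T_exists f D hD e
  refine ⟨∑ ij ∈ Finset.HasAntidiagonal.antidiagonal l,
    (LinearMap.mulLeft E (T ij.2 * f ^ ij.1)) ∘ₗ (hasseDeriv ij.1), fun a => ⟨?_, ?_⟩⟩
  · rw [hasseDeriv_mul, LinearMap.sum_apply, Finset.mul_sum, Finset.mul_sum]
    refine Finset.sum_congr rfl fun ij hij => ?_
    have : ij.1 + ij.2 = l := by simpa using hij
    rw [← this, pow_add]
    simp only [LinearMap.comp_apply, LinearMap.mulLeft_apply]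
    calc _ = (f ^ ij.2 * hasseDeriv ij.2 (f ^ e)) * (f ^ ij.1 * hasseDeriv ij.1 a) := by ring
        _ = _ := by rw [hT]; ring
  · rw [LinearMap.sum_apply]
    refine natDegree_sum_le_of_forall_le _ _ fun ij hij => ?_
    have : ij.1 + ij.2 = l := by simpa using hij
    simp only [LinearMap.comp_apply, LinearMap.mulLeft_apply]
    refine natDegree_mul_le.trans ?_
    have a0 := natDegree_mul_le (p := T ij.2) (q := f ^ ij.1)
    have a1 := hTd ij.2
    have a2 := natDegree_pow_le (p := f) (n := ij.1)
    have a3 : ij.1 * f.natDegree ≤ ij.1 * D := Nat.mul_le_mul_left _ hD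
    have a4 := natDegree_hasseDeriv_le a ij.1
    have : l * D = ij.1 * D + ij.2 * D := by rw [← add_mul]; congr; omega
    omega


open Polynomial in
lemma sc_resultant_degree {E : Type*} [Field E] (A G : E[X][X]) (m n B D : ℕ)
    (hA : ∀ i, (A.coeff i).natDegree ≤ B) (hG : ∀ i, (G.coeff i).natDegree ≤ D) :
    (resultant A G m n).natDegree ≤ m * D + n * B := by
  unfold resultant
  rw [Matrix.det_apply]
  refine natDegree_sum_le_of_forall_le _ _ fun σ _ => ?_
  refine (natDegree_smul_le _ _).trans ?_
  refine (natDegree_prod_le _ _).trans ?_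
  rw [Fin.sum_univ_add]
  refine add_le_add ?_ ?_
  · refine (Finset.sum_le_card_nsmul _ _ D ?_).trans (by simp)
    intro i _
    simp only [sylvester, Matrix.of_apply, Fin.addCases_left]
    split_ifs
    · exact hG _
    · simp
  · refine (Finset.sum_le_card_nsmul _ _ B ?_).trans (by simp)
    intro i _
    simp only [sylvester, Matrix.of_apply, Fin.addCases_right]
    split_ifs
    · exact hA _
    · simp

open Polynomial in
lemma sc_core {E : Type*} [Field E] [Fintype E] (f : E[X]) (Q r e B D : ℕ) (hr : r.Prime)
    (hQ : Fintype.card E = Q) (he : 1 + r * e = Q)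
    (hD : f.natDegree ≤ D) (h0 : f.eval 0 ≠ 0)
    (hnp : ∀ c : E, c ≠ 0 → ∀ u v : E[X], u ≠ 0 → v ≠ 0 → f * u ^ r ≠ C c * v ^ r)
    (hB : r * (B + D) < Q)
    (b : ℕ → E[X]) (hb : ∀ j, (b j).natDegree ≤ B)
    (hdvd : X ^ Q ∣ ∑ j ∈ Finset.range r, b j * (f ^ e) ^ j) :
    ∀ j < r, b j = 0 := by
  set c := f.eval 0 with hc
  have hf0 : f ≠ 0 := by rintro rfl; simp at hc; exact h0 hc
  by_contra! hcon
  obtain ⟨j0, hj0, hbj0⟩ := hcon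
  set A : E[X][X] := ∑ j ∈ Finset.range r, C (b j) * X ^ j with hAdef
  set G : E[X][X] := C f * X ^ r - C (C c) with hGdef
  have hAcoeff : ∀ i, A.coeff i = if i < r then b i else 0 := by
    intro i
    simp only [hAdef, finsetSum_coeff, coeff_C_mul_X_pow]
    simp
  have hA0 : A ≠ 0 := by
    intro h
    have := hAcoeff j0
    rw [h, if_pos hj0] at this
    exact hbj0 (by simpa using this.symm)
  have hAdeg : A.natDegree < r := by
    rw [natDegree_lt_iff_degree_lt hA0, degree_lt_iff_coeff_zero]
    intro m hm
    rw [hAcoeff, if_neg (by omega)]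
  have hGcoeff : ∀ i, (G.coeff i).natDegree ≤ D := by
    intro i
    simp only [hGdef, coeff_sub, coeff_C_mul_X_pow, coeff_C]
    refine (natDegree_sub_le _ _).trans (max_le ?_ ?_)
    · split_ifs <;> simp [hD]
    · split_ifs <;> simp
  have hGdeg : G.natDegree = r := by
    rw [hGdef, natDegree_sub_C, natDegree_C_mul_X_pow _ _ hf0]
  obtain ⟨p, q, -, -, hpq⟩ := exists_mul_add_mul_eq_C_resultant (m := A.natDegree)
    (n := G.natDegree) A G le_rfl le_rfl (Or.inr (by rw [hGdeg]; exact hr.ne_zero))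
  -- R is divisible by X^Q
  have hRdvd : X ^ Q ∣ A.resultant G := by
    have h1 := congrArg (eval (f ^ e)) hpq
    rw [eval_C, eval_add, eval_mul, eval_mul] at h1
    rw [← h1]
    refine dvd_add (Dvd.dvd.mul_right ?_ _) (Dvd.dvd.mul_right ?_ _)
    · simpa [hAdef, eval_finsetSum] using hdvd
    · have : eval (f ^ e) G = f ^ Q - C c := by
        simp only [hGdef, eval_sub, eval_mul, eval_C, eval_pow, eval_X]
        rw [← he]; ring
      rw [this, ← hQ, ← FiniteField.expand_card f]
      have hf : f = divX f * X + C c := by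
        rw [hc, ← coeff_zero_eq_eval_zero]; exact (divX_mul_X_add f).symm
      have h2 : expand E (Fintype.card E) f - C c =
          X ^ Fintype.card E * expand E (Fintype.card E) (divX f) := by
        conv_lhs => rw [hf]
        simp only [map_add, map_mul, expand_X, expand_C]
        ring
      rw [h2]
      exact Dvd.intro _ rfl
  have hRdeg := sc_resultant_degree A G A.natDegree G.natDegree B D
    (fun i => by rw [hAcoeff]; split_ifs <;> simp [hb]) hGcoeff
  have hR0 : A.resultant G ≠ 0 := by
    let K := FractionRing E[X]
    let φ : E[X] →+* K := algebraMap E[X] K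
    have hφ : Function.Injective φ := IsFractionRing.injective E[X] K
    intro hR
    have h1 := resultant_map_map A G A.natDegree G.natDegree φ
    have h2 := resultant_ne_zero (A.map φ) (G.map φ) ?_
    · rw [natDegree_map_eq_of_injective hφ, natDegree_map_eq_of_injective hφ, h1, hR] at h2
      simp at h2
    · have hfφ : φ f ≠ 0 := (map_ne_zero_iff φ hφ).2 hf0
      have hirr : Irreducible (X ^ r - C (φ (C c) / φ f)) := by
        refine X_pow_sub_C_irreducible_of_prime hr ?_
        intro y hy
        obtain ⟨u, v, hv, rfl⟩ := IsFractionRing.div_surjective (A := E[X]) y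
        have hv0 : v ≠ 0 := nonZeroDivisors.ne_zero hv
        have hvφ : φ v ≠ 0 := (map_ne_zero_iff φ hφ).2 hv0
        change (φ u / φ v) ^ r = _ at hy
        have hu0 : u ≠ 0 := by
          rintro rfl
          rw [map_zero, zero_div, zero_pow hr.ne_zero, eq_comm, div_eq_zero_iff] at hy
          rcases hy with hy | hy
          · rw [map_eq_zero_iff φ hφ] at hy
            simp at hy; exact h0 hy
          · exact hfφ hy
        refine hnp c h0 u v hu0 hv0 (hφ ?_)
        rw [div_pow, div_eq_div_iff (pow_ne_zero _ hvφ) hfφ] at hy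
        simp only [map_mul, map_pow]
        rw [mul_comm, hy]
      have hG : G.map φ = C (φ f) * (X ^ r - C (φ (C c) / φ f)) := by
        rw [mul_sub, ← C_mul, mul_div_cancel₀ _ hfφ]
        simp [hGdef]
      rw [hG]
      refine IsCoprime.symm ?_
      rw [isCoprime_mul_unit_left_left (isUnit_C.2 (isUnit_iff_ne_zero.2 hfφ))]
      rw [hirr.coprime_iff_not_dvd]
      intro hd
      have := natDegree_le_of_dvd hd ((Polynomial.map_ne_zero_iff hφ).2 hA0)
      rw [natDegree_X_pow_sub_C, natDegree_map_eq_of_injective hφ] at this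
      omega
  have h3 := natDegree_le_of_dvd hRdvd hR0
  rw [natDegree_X_pow] at h3
  rw [hGdeg] at *
  have : A.natDegree * D ≤ r * D := Nat.mul_le_mul_right _ hAdeg.le
  have : r * (B + D) = r * D + r * B := by ring
  omega

open Polynomial in
lemma sc_indep {E : Type*} [Field E] [Fintype E] (f : E[X]) (Q r e B D K : ℕ) (hr : r.Prime)
    (hQ : Fintype.card E = Q) (he : 1 + r * e = Q)
    (hD : f.natDegree ≤ D) (h0 : f.eval 0 ≠ 0)
    (hnp : ∀ c : E, c ≠ 0 → ∀ u v : E[X], u ≠ 0 → v ≠ 0 → f * u ^ r ≠ C c * v ^ r)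
    (hB : r * (B + D) < Q)
    (a : ℕ → ℕ → E[X]) (ha : ∀ j k, (a j k).natDegree ≤ B)
    (hz : ∑ k ∈ Finset.range K, ∑ j ∈ Finset.range r, a j k * (f ^ e) ^ j * X ^ (Q * k) = 0) :
    ∀ k < K, ∀ j < r, a j k = 0 := by
  intro k
  induction k using Nat.strong_induction_on with
  | _ k ih =>
    intro hk
    refine sc_core f Q r e B D hr hQ he hD h0 hnp hB (fun j => a j k) (fun j => ha j k) ?_
    have hX : (X ^ (Q * k) : E[X]) ≠ 0 := pow_ne_zero _ X_ne_zero
    rw [← mul_dvd_mul_iff_right hX, Finset.sum_mul]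
    rw [← Finset.add_sum_erase _ _ (Finset.mem_range.2 hk), add_eq_zero_iff_eq_neg] at hz
    rw [hz]
    refine Dvd.dvd.neg_right ?_ |> fun h => h
    refine Finset.dvd_sum fun k' hk' => ?_
    rw [Finset.mem_erase, Finset.mem_range] at hk'
    rcases lt_or_gt_of_ne hk'.1 with h | h
    · rw [Finset.sum_eq_zero]
      · exact dvd_zero _
      · intro j hj
        rw [ih k' h hk'.2 j (Finset.mem_range.1 hj)]; simp
    · refine Finset.dvd_sum fun j _ => Dvd.dvd.mul_left ?_ _
      rw [← pow_add]
      refine pow_dvd_pow _ ?_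
      calc Q + Q * k = Q * (k + 1) := by ring
        _ ≤ Q * k' := Nat.mul_le_mul_left _ h


open Polynomial in
lemma sc_pow_dvd {E : Type*} [Field E] (H : E[X]) (x : E) (M : ℕ)
    (h : ∀ l < M, (hasseDeriv l H).eval x = 0) : (X - C x) ^ M ∣ H := by
  rw [X_sub_C_pow_dvd_iff, X_pow_dvd_iff]
  intro d hd
  have := taylor_coeff x H d
  rw [taylor_apply] at this
  rw [this, h d hd]

open Polynomial in
lemma sc_stepanov_aux {E : Type*} [Field E] [Fintype E] (f : E[X]) (Q r e B D K M : ℕ)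
    (hr : r.Prime)
    (hQ : Fintype.card E = Q) (he : 1 + r * e = Q)
    (hD : f.natDegree ≤ D) (h0 : f.eval 0 ≠ 0)
    (hnp : ∀ c : E, c ≠ 0 → ∀ u v : E[X], u ≠ 0 → v ≠ 0 → f * u ^ r ≠ C c * v ^ r)
    (hB : r * (B + D) < Q) (hM : M ≤ Q)
    (hcount : M * (B + 1 + K + M * D) < r * (K * (B + 1)))
    (ζ : E) (Z : Finset E) (hZ : ∀ x ∈ Z, f.eval x ≠ 0 ∧ (f.eval x) ^ e = ζ) :
    Z.card * M ≤ B + Q * D + Q * K := by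
  classical
  choose U hU hUd using fun j l => sc_U_exists f D hD (e * j) l
  let N := B + 1 + K + M * D
  let Φ0 : ∀ l : Fin M, (Fin r → Fin K → degreeLT E (B + 1)) →ₗ[E] E[X] := fun l =>
    ∑ k : Fin K, ∑ j : Fin r, (LinearMap.mulLeft E (C (ζ ^ (j : ℕ)) * X ^ (k : ℕ))) ∘ₗ (U j l) ∘ₗ
      (Submodule.subtype _) ∘ₗ (LinearMap.proj k) ∘ₗ (LinearMap.proj j)
  have hΦ0 : ∀ l a, Φ0 l a = ∑ k : Fin K, ∑ j : Fin r,
      C (ζ ^ (j : ℕ)) * X ^ (k : ℕ) * U j l (a j k : E[X]) := by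
    intro l a
    simp [Φ0, LinearMap.sum_apply, mul_assoc]
  have hdegB : ∀ p : degreeLT E (B + 1), (p : E[X]).natDegree ≤ B := by
    intro p
    have := mem_degreeLT.1 p.2
    by_cases hp : (p : E[X]) = 0
    · simp [hp]
    · rw [← natDegree_lt_iff_degree_lt hp] at this
      omega
  have hmem : ∀ l a, Φ0 l a ∈ degreeLT E N := by
    intro l a
    rw [hΦ0]
    refine Submodule.sum_mem _ fun k _ => Submodule.sum_mem _ fun j _ => ?_
    rw [mem_degreeLT]
    refine degree_le_natDegree.trans_lt ?_
    have h1 : (C (ζ ^ (j : ℕ)) * X ^ (k : ℕ) * U j l (a j k : E[X])).natDegree < N := by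
      refine natDegree_mul_le.trans_lt ?_
      have h1 := natDegree_C_mul_X_pow_le (ζ ^ (j : ℕ)) k
      have h2 := hUd j l (a j k)
      have h3 := hdegB (a j k)
      have h4 : (l : ℕ) * D ≤ M * D := Nat.mul_le_mul_right _ l.2.le
      have h5 := k.2
      simp only [N]
      omega
    exact_mod_cast h1
  let Φ : (Fin r → Fin K → degreeLT E (B + 1)) →ₗ[E] (Fin M → degreeLT E N) :=
    LinearMap.pi fun l => LinearMap.codRestrict _ (Φ0 l) (hmem l)
  have hfr : ∀ n, Module.finrank E (degreeLT E n) = n := fun n => by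
    rw [(degreeLTEquiv E n).finrank_eq]; simp
  have hfin : ∀ n, Module.Finite E (degreeLT E n) := fun n =>
    Module.Finite.equiv (degreeLTEquiv E n).symm
  have hker : LinearMap.ker Φ ≠ ⊥ := by
    refine LinearMap.ker_ne_bot_of_finrank_lt ?_
    simp only [Module.finrank_pi_fintype, hfr, Finset.sum_const, Finset.card_univ,
      Fintype.card_fin, smul_eq_mul]
    exact hcount
  obtain ⟨a, hak, ha0⟩ := Submodule.exists_mem_ne_zero_of_ne_bot hker
  have haz : ∀ l, Φ0 l a = 0 := by
    intro l
    have := congrFun (LinearMap.mem_ker.1 hak) l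
    exact congrArg Subtype.val this
  let a' : ℕ → ℕ → E[X] := fun j k => if h : j < r ∧ k < K then (a ⟨j, h.1⟩ ⟨k, h.2⟩ : E[X]) else 0
  have ha' : ∀ (j : Fin r) (k : Fin K), a' j k = a j k := by
    intro j k
    simp [a', j.2, k.2]
  have ha'd : ∀ j k, (a' j k).natDegree ≤ B := by
    intro j k
    simp only [a']
    split_ifs
    · exact hdegB _
    · simp
  set h := ∑ k ∈ Finset.range K, ∑ j ∈ Finset.range r, a' j k * (f ^ e) ^ j * X ^ (Q * k) with hh
  have hne : h ≠ 0 := by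
    intro hz
    apply ha0
    have := sc_indep f Q r e B D K hr hQ he hD h0 hnp hB a' ha'd hz
    ext1 j; ext1 k
    apply Subtype.ext
    rw [← ha', this k k.2 j j.2]
    rfl
  have hdeg : h.natDegree ≤ B + Q * D + Q * K := by
    refine natDegree_sum_le_of_forall_le _ _ fun k hk => natDegree_sum_le_of_forall_le _ _ fun j hj => ?_
    rw [Finset.mem_range] at hk hj
    refine natDegree_mul_le.trans ?_
    refine add_le_add (natDegree_mul_le.trans (add_le_add (ha'd _ _) ?_)) ?_
    · rw [← pow_mul]
      refine natDegree_pow_le.trans (Nat.mul_le_mul ?_ hD)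
      rw [← he, mul_comm]
      have := Nat.mul_le_mul_right e hj.le
      omega
    · rw [natDegree_X_pow]
      exact Nat.mul_le_mul_left _ hk.le
  have hdvd : ∀ x ∈ Z, (X - C x) ^ M ∣ h := by
    intro x hx
    obtain ⟨hx0, hxζ⟩ := hZ x hx
    have hXQ : (X : E[X]) ^ Q - C x = (X - C x) ^ Q := by
      rw [← hQ, ← FiniteField.expand_card (X - C x)]
      simp
    set H := ∑ k ∈ Finset.range K, ∑ j ∈ Finset.range r, C (x ^ k) * (a' j k * f ^ (e * j)) with hH
    have h1 : (X - C x) ^ M ∣ h - H := by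
      rw [hh, hH, ← Finset.sum_sub_distrib]
      refine Finset.dvd_sum fun k _ => ?_
      rw [← Finset.sum_sub_distrib]
      refine Finset.dvd_sum fun j _ => ?_
      have : a' j k * (f ^ e) ^ j * X ^ (Q * k) - C (x ^ k) * (a' j k * f ^ (e * j)) =
        a' j k * (f ^ e) ^ j * ((X ^ Q) ^ k - (C x) ^ k) := by
        rw [C_pow]; ring
      rw [this]
      refine Dvd.dvd.mul_left ?_ _
      refine dvd_trans ?_ (sub_dvd_pow_sub_pow _ _ k)
      rw [hXQ]
      exact pow_dvd_pow _ hM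
    have h2 : (X - C x) ^ M ∣ H := by
      refine sc_pow_dvd H x M fun l hl => ?_
      have h3 : (f.eval x) ^ l * (hasseDeriv l H).eval x = 0 := by
        rw [← eval_pow, ← eval_mul, hH, map_sum, Finset.mul_sum, eval_finsetSum]
        have h4 := congrArg (eval x) (haz ⟨l, hl⟩)
        rw [hΦ0, eval_finsetSum, eval_zero] at h4
        rw [← h4, ← Fin.sum_univ_eq_sum_range (fun k => eval x (f ^ l *
          (hasseDeriv l) (∑ j ∈ Finset.range r, C (x ^ k) * (a' j k * f ^ (e * j))))) K]
        refine Finset.sum_congr rfl fun k _ => ?_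
        rw [map_sum, Finset.mul_sum, eval_finsetSum, eval_finsetSum,
          ← Fin.sum_univ_eq_sum_range (fun j => eval x (f ^ l *
          (hasseDeriv l) (C (x ^ (k : ℕ)) * (a' j k * f ^ (e * j))))) r]
        refine Finset.sum_congr rfl fun j _ => ?_
        rw [← smul_eq_C_mul, map_smul, mul_smul_comm, hU, ha']
        simp only [eval_smul, eval_mul, eval_pow, eval_C, eval_X, smul_eq_mul]
        rw [pow_mul, hxζ]
        ring
      rcases mul_eq_zero.1 h3 with h | h
      · exact absurd h (pow_ne_zero _ hx0)
      · exact h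
    have := dvd_add h1 h2
    rwa [sub_add_cancel] at this
  have hprod : ∏ x ∈ Z, (X - C x) ^ M ∣ h := by
    refine Finset.prod_dvd_of_coprime ?_ hdvd
    intro x _ y _ hxy
    exact IsCoprime.pow (isCoprime_X_sub_C_of_isUnit_sub (by
      rw [isUnit_iff_ne_zero]; exact sub_ne_zero.2 hxy))
  have h5 := natDegree_le_of_dvd hprod hne
  rw [natDegree_prod_of_monic _ _ (fun x _ => (monic_X_sub_C x).pow M)] at h5
  simp only [natDegree_pow, natDegree_X_sub_C, mul_one, Finset.sum_const, smul_eq_mul] at h5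
  omega

set_option maxHeartbeats 1000000 in
open Polynomial in
lemma sc_stepanov {E : Type*} [Field E] [Fintype E] (f : E[X]) (Q r e D : ℕ)
    (hr : r.Prime)
    (hQ : Fintype.card E = Q) (he : 1 + r * e = Q)
    (hD : f.natDegree ≤ D) (h0 : f.eval 0 ≠ 0)
    (hnp : ∀ c : E, c ≠ 0 → ∀ u v : E[X], u ≠ 0 → v ≠ 0 → f * u ^ r ≠ C c * v ^ r)
    (ζ : E) (Z : Finset E) (hZ : ∀ x ∈ Z, f.eval x ≠ 0 ∧ (f.eval x) ^ e = ζ) :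
    (Z.card : ℝ) ≤ Q / r + (8 * r * (D + 2)) * Real.sqrt Q := by
  have hr2 := hr.two_le
  have hZQ : Z.card ≤ Q := hQ ▸ Finset.card_le_univ Z
  set M := Nat.sqrt Q with hMdef
  set c := 2 * r * (D + 2) with hcdef
  have hM1 : (M : ℝ) ≤ Real.sqrt Q := Real.nat_sqrt_le_real_sqrt
  have hM2 : Real.sqrt Q ≤ M + 1 := Real.real_sqrt_le_nat_sqrt_succ
  have hs0 : 0 ≤ Real.sqrt Q := Real.sqrt_nonneg _
  have hsq : Real.sqrt Q * Real.sqrt Q = Q := Real.mul_self_sqrt (by positivity)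
  have hrR : (2 : ℝ) ≤ r := by exact_mod_cast hr2
  have hDR : (0 : ℝ) ≤ D := by positivity
  have hcR : (c : ℝ) = 2 * r * (D + 2) := by rw [hcdef]; push_cast; ring
  by_cases hbig : M ≤ c + 3
  · have h1 : (M : ℝ) ≤ c + 3 := by exact_mod_cast hbig
    have h2 : Real.sqrt Q ≤ 8 * r * (D + 2) := by nlinarith
    have h3 : (Z.card : ℝ) ≤ Q := by exact_mod_cast hZQ
    have h4 : (0 : ℝ) ≤ Q / r := by positivity
    nlinarith
  push Not at hbig
  have hMM : M * M ≤ Q := Nat.sqrt_le Q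
  set K := (M + c) / r + 1 with hK
  set B := Q / r - D - 1 with hBdef
  have hQr : r * (Q / r) ≤ Q := Nat.mul_div_le Q r
  have hQr' : Q < r * (Q / r) + r := by
    have := Nat.lt_mul_div_succ Q hr.pos
    linarith [mul_add r (Q / r) 1]
  have hcQ : c * c ≤ Q := by nlinarith
  have hcpos : 0 < c := by positivity
  have hQbig : D + 2 ≤ Q / r := by
    rw [Nat.le_div_iff_mul_le hr.pos]
    nlinarith
  have hB1 : B + D + 1 = Q / r := by omega
  have hBr : r * (B + D) + r = r * (Q / r) := by rw [← hB1]; ring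
  have hKr1 : M + c < r * K := Nat.lt_mul_div_succ _ hr.pos
  have hKr2 : r * K ≤ M + c + r := by
    have := Nat.mul_div_le (M + c) r
    rw [hK, mul_add]; omega
  have hKM : K ≤ M + c + 1 := by
    have := Nat.div_le_self (M + c) r
    omega
  have hcount : M * (B + 1 + K + M * D) < r * (K * (B + 1)) := by
    -- (B+1) * (rK - M) ≥ (B+1)(c+1)
    have e1 : (B + 1) * (M + c + 1) ≤ r * (K * (B + 1)) := by
      calc (B + 1) * (M + c + 1) ≤ (B + 1) * (r * K) := Nat.mul_le_mul_left _ hKr1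
        _ = _ := by ring
    -- (B+1) c ≥ Q (D+2)
    have e2 : Q ≤ 2 * r * (B + 1) := by
      have : r * (B + 1) + r * D = r * (Q / r) := by rw [← hB1]; ring
      have : 2 * (r * D + r) ≤ Q := by nlinarith
      nlinarith
    have e3 : Q * (D + 2) ≤ (B + 1) * c := by
      calc Q * (D + 2) ≤ (2 * r * (B + 1)) * (D + 2) := Nat.mul_le_mul_right _ e2
        _ = _ := by rw [hcdef]; ring
    have e4 : M * K ≤ 2 * Q := by
      calc M * K ≤ M * (M + M) := Nat.mul_le_mul_left _ (by omega)
        _ = 2 * (M * M) := by ring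
        _ ≤ 2 * Q := by omega
    have e5 : M * (M * D) ≤ Q * D := by
      rw [← mul_assoc]; exact Nat.mul_le_mul_right _ hMM
    have e6 : M * (B + 1 + K + M * D) = (B + 1) * M + M * K + M * (M * D) := by ring
    have e7 : (B + 1) * (M + c + 1) = (B + 1) * M + (B + 1) * c + (B + 1) := by ring
    have e8 : Q * (D + 2) = Q * D + 2 * Q := by ring
    omega
  have hfin := sc_stepanov_aux f Q r e B D K M hr hQ he hD h0 hnp
    (by have := hr.pos; omega) (hMdef ▸ Nat.sqrt_le_self Q) hcount ζ Z hZ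
  have hBQ : B ≤ Q := (Nat.sub_le _ _).trans ((Nat.sub_le _ _).trans (Nat.div_le_self _ _))
  have h1 : Z.card * M ≤ Q * (D + 1 + K) := by nlinarith
  have h2 : r * (Z.card * M) ≤ Q * (M + (r * D + 2 * r + c)) := by
    calc r * (Z.card * M) ≤ r * (Q * (D + 1 + K)) := Nat.mul_le_mul_left _ h1
      _ = Q * (r * D + r + r * K) := by ring
      _ ≤ _ := Nat.mul_le_mul_left _ (by omega)
  have h3 : (r : ℝ) * (Z.card * M) ≤ Q * (M + (r * D + 2 * r + c)) := by exact_mod_cast h2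
  have hMpos : (1 : ℝ) ≤ M := by
    have : 1 ≤ M := by omega
    exact_mod_cast this
  have hMs : Real.sqrt Q ≤ 2 * M := by linarith
  have hrM : (0 : ℝ) < r * M := by positivity
  have h4 : (Z.card : ℝ) ≤ Q * (M + (r * D + 2 * r + c)) / (r * M) := by
    rw [le_div_iff₀ hrM]; linarith
  refine h4.trans ?_
  rw [div_le_iff₀ hrM, hcR]
  have h5 : (Q / r + 8 * r * (D + 2) * Real.sqrt Q) * (r * M) =
    Q * M + 8 * r * (D + 2) * r * (Real.sqrt Q * M) := by
    field_simp
  rw [h5]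
  have h6 : (Q : ℝ) ≤ 2 * (Real.sqrt Q * M) := by nlinarith
  have h7 : (r : ℝ) * D + 2 * r + 2 * r * (D + 2) = 3 * (r * (D + 2)) := by ring
  rw [h7, mul_add]
  have h8 : (0 : ℝ) ≤ r * (D + 2) := by positivity
  have h9 : 0 ≤ Real.sqrt Q * M := by positivity
  have h10 : (Q : ℝ) * (3 * (r * (D + 2))) ≤ 6 * (r * (D + 2)) * (Real.sqrt Q * M) := by
    nlinarith
  have h11 : 6 * (r * (D + 2)) * (Real.sqrt Q * M) ≤ 8 * r * (D + 2) * r * (Real.sqrt Q * M) := by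
    refine mul_le_mul_of_nonneg_right ?_ h9
    nlinarith
  linarith


open Polynomial in
lemma sc_charsum {E : Type*} [Field E] [Fintype E] (f : E[X]) (r D : ℕ)
    (hr : r.Prime) (η : MulChar E ℂ) (hη1 : η ≠ 1) (hηr : η ^ r = 1)
    (hD : f.natDegree ≤ D) (h0 : f.eval 0 ≠ 0)
    (hnp : ∀ c : E, c ≠ 0 → ∀ u v : E[X], u ≠ 0 → v ≠ 0 → f * u ^ r ≠ C c * v ^ r) :
    ‖∑ x : E, η (f.eval x)‖ ≤ (r * (8 * r * (D + 2)) + D) * Real.sqrt (Fintype.card E) := by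
  classical
  have hf0 : f ≠ 0 := by rintro rfl; simp at h0
  obtain ⟨γ, hγ⟩ := IsCyclic.exists_generator (α := Eˣ)
  set ω : ℂ := η (γ : E) with hω
  have hpowr : ∀ y : Eˣ, (η (y : E)) ^ r = 1 := by
    intro y
    have := congrArg (fun χ : MulChar E ℂ => χ (y : E)) hηr
    simpa [MulChar.pow_apply_coe] using this
  have hωr : ω ^ r = 1 := hpowr γ
  have hω1 : ω ≠ 1 := by
    intro h
    apply hη1
    ext y
    obtain ⟨k, hk⟩ := Subgroup.mem_zpowers_iff.1 (hγ y)
    obtain ⟨n, hn⟩ := (isOfFinOrder_of_finite γ).mem_powers_iff_mem_zpowers.2 (hγ y)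
    simp only at hn
    rw [← hn, Units.val_pow_eq_pow_val, map_pow, ← hω, h]
    simp
  have hprim : IsPrimitiveRoot ω r := by
    haveI : Fact r.Prime := ⟨hr⟩
    rw [IsPrimitiveRoot.iff_orderOf]
    exact orderOf_eq_prime hωr hω1
  set Q := Fintype.card E with hQ
  have hQ1 : 1 ≤ Q := Fintype.card_pos
  have hdvd : r ∣ Q - 1 := by
    apply hprim.dvd_of_pow_eq_one
    rw [hω, ← map_pow, FiniteField.pow_card_sub_one_eq_one _ γ.ne_zero, map_one]
  obtain ⟨e, he⟩ := hdvd
  have he' : 1 + r * e = Q := by omega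
  have hκ : ∀ y : E, ∃ k : ℕ, k < r ∧ (y ≠ 0 → η y = ω ^ k ∧ y ^ e = ((γ : E) ^ e) ^ k) := by
    intro y
    by_cases hy : y = 0
    · exact ⟨0, hr.pos, fun h => absurd hy h⟩
    · obtain ⟨n, hn⟩ := (isOfFinOrder_of_finite γ).mem_powers_iff_mem_zpowers.2 (hγ (Units.mk0 y hy))
      simp only at hn
      have hn' : y = (γ : E) ^ n := by
        rw [← Units.val_pow_eq_pow_val, hn]; rfl
      refine ⟨n % r, Nat.mod_lt _ hr.pos, fun _ => ⟨?_, ?_⟩⟩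
      · rw [hn', map_pow, ← hω]
        exact pow_eq_pow_mod n hωr
      · have h1 : ((γ : E) ^ e) ^ r = 1 := by
          rw [← pow_mul, mul_comm, ← he]
          exact FiniteField.pow_card_sub_one_eq_one _ γ.ne_zero
        rw [hn', ← pow_mul, mul_comm, pow_mul]
        exact pow_eq_pow_mod n h1
  choose κ hκr hκ using hκ
  set W : Finset E := Finset.univ.filter (fun x => f.eval x ≠ 0) with hW
  set A : ℕ → Finset E := fun i => W.filter (fun x => κ (f.eval x) = i) with hA
  have hmaps : ∀ x ∈ W, κ (f.eval x) ∈ Finset.range r := fun x _ => Finset.mem_range.2 (hκr _)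
  have hcardA : ∀ i, ((A i).card : ℝ) ≤ Q / r + (8 * r * (D + 2)) * Real.sqrt Q := by
    intro i
    refine sc_stepanov f Q r e D hr rfl he' hD h0 hnp (((γ : E) ^ e) ^ i) (A i) ?_
    intro x hx
    simp only [hA, hW, Finset.mem_filter, Finset.mem_univ, true_and] at hx
    exact ⟨hx.1, by rw [(hκ _ hx.1).2, hx.2]⟩
  have hWcard : (Q : ℝ) - D ≤ ∑ i ∈ Finset.range r, ((A i).card : ℝ) := by
    have h1 := Finset.card_eq_sum_card_fiberwise hmaps
    have h2 : Q ≤ W.card + D := by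
      have h3 : (Finset.univ.filter (fun x => f.eval x = 0)).card ≤ D := by
        refine le_trans ?_ ((card_roots' f).trans hD)
        refine le_trans (Finset.card_le_card ?_) (Multiset.toFinset_card_le _)
        intro x hx
        simp only [Finset.mem_filter, Finset.mem_univ, true_and] at hx
        simp [hf0, hx]
      have h4 := Finset.card_filter_add_card_filter_not (s := (Finset.univ : Finset E))
        (fun x => f.eval x = 0)
      rw [Finset.card_univ, ← hQ] at h4
      have h5 : W.card = (Finset.univ.filter (fun x => ¬ f.eval x = 0)).card := rfl
      omega
    have h3 : (W.card : ℝ) = ∑ i ∈ Finset.range r, ((A i).card : ℝ) := by exact_mod_cast h1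
    rw [← h3]
    have : (Q : ℝ) ≤ W.card + D := by exact_mod_cast h2
    linarith
  have hsum : ∑ x : E, η (f.eval x) = ∑ i ∈ Finset.range r, ((A i).card : ℂ) * ω ^ i := by
    have h1 : ∑ x : E, η (f.eval x) = ∑ x ∈ W, η (f.eval x) := by
      rw [hW, Finset.sum_filter]
      refine Finset.sum_congr rfl fun x _ => ?_
      split_ifs with h
      · rfl
      · push Not at h
        rw [h]; exact MulChar.map_zero η
    rw [h1, ← Finset.sum_fiberwise_of_maps_to hmaps]
    refine Finset.sum_congr rfl fun i _ => ?_
    rw [Finset.sum_congr rfl (g := fun _ => ω ^ i)]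
    · simp [hA]
    · intro x hx
      simp only [hW, Finset.mem_filter, Finset.mem_univ, true_and] at hx
      rw [(hκ _ hx.1).1, hx.2]
  have hgeom : ∑ i ∈ Finset.range r, ω ^ i = 0 := hprim.geom_sum_eq_zero hr.one_lt
  set T : ℝ := Q / r + (8 * r * (D + 2)) * Real.sqrt Q with hT
  have hsum2 : ∑ x : E, η (f.eval x) =
      ∑ i ∈ Finset.range r, (((A i).card - T : ℝ) : ℂ) * ω ^ i := by
    rw [hsum]
    have : ∀ i, (((A i).card - T : ℝ) : ℂ) * ω ^ i = ((A i).card : ℂ) * ω ^ i - T * ω ^ i := by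
      intro i; push_cast; ring
    simp_rw [this]
    rw [Finset.sum_sub_distrib, ← Finset.mul_sum, hgeom]
    simp
  rw [hsum2]
  have hωn : ‖ω‖ = 1 := hprim.norm'_eq_one hr.ne_zero
  calc _ ≤ ∑ i ∈ Finset.range r, ‖(((A i).card - T : ℝ) : ℂ) * ω ^ i‖ := norm_sum_le _ _
    _ = ∑ i ∈ Finset.range r, (T - (A i).card) := by
      refine Finset.sum_congr rfl fun i _ => ?_
      rw [norm_mul, norm_pow, hωn, one_pow, mul_one, Complex.norm_real, Real.norm_eq_abs,
        abs_of_nonpos (by linarith [hcardA i])]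
      ring
    _ = r * T - ∑ i ∈ Finset.range r, ((A i).card : ℝ) := by
      rw [Finset.sum_sub_distrib]; simp
    _ ≤ r * T - (Q - D) := by linarith
    _ = r * (8 * r * (D + 2)) * Real.sqrt Q + D := by
      have : (r : ℝ) ≠ 0 := by exact_mod_cast hr.ne_zero
      rw [hT]; field_simp; ring
    _ ≤ _ := by
      have : (1 : ℝ) ≤ Real.sqrt Q := by
        rw [Real.one_le_sqrt]; exact_mod_cast hQ1
      have hD0 : (0 : ℝ) ≤ D := by positivity
      nlinarith


open Polynomial in
lemma sc_monic_finite (F : Type*) [Field F] [Finite F] (n : ℕ) :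
    {h : F[X] | h.Monic ∧ h.natDegree = n}.Finite := by
  have h1 : Finite (degreeLT F (n + 1)) := Finite.of_equiv _ (degreeLTEquiv F (n + 1)).symm.toEquiv
  have h2 : ((degreeLT F (n + 1) : Submodule F F[X]) : Set F[X]).Finite := Set.toFinite _
  refine h2.subset ?_
  rintro h ⟨_, hn⟩
  rw [SetLike.mem_coe, mem_degreeLT]
  refine degree_le_natDegree.trans_lt ?_
  rw [hn]
  exact_mod_cast Nat.lt_succ_self n

/-- monic polynomials of degree n -/
noncomputable def scMon (F : Type*) [Field F] [Finite F] (n : ℕ) : Finset (Polynomial F) :=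
  (sc_monic_finite F n).toFinset

open Polynomial in
lemma sc_mem_mon {F : Type*} [Field F] [Finite F] {n : ℕ} {h : F[X]} :
    h ∈ scMon F n ↔ h.Monic ∧ h.natDegree = n := by
  simp [scMon]

open Classical in
/-- monic irreducible polynomials of degree at most n -/
noncomputable def scIrr (F : Type*) [Field F] [Finite F] (n : ℕ) : Finset (Polynomial F) :=
  ((Finset.range (n + 1)).biUnion (scMon F)).filter Irreducible

open Polynomial in
lemma sc_mem_irr {F : Type*} [Field F] [Finite F] {n : ℕ} {h : F[X]} :
    h ∈ scIrr F n ↔ h.Monic ∧ h.natDegree ≤ n ∧ Irreducible h := by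
  classical
  simp only [scIrr, Finset.mem_filter, Finset.mem_biUnion, Finset.mem_range, sc_mem_mon]
  constructor
  · rintro ⟨⟨d, hd, hm, rfl⟩, hi⟩
    exact ⟨hm, by omega, hi⟩
  · rintro ⟨hm, hd, hi⟩
    exact ⟨⟨_, by omega, hm, rfl⟩, hi⟩

open Polynomial Classical in
lemma sc_degree_eq {F : Type*} [Field F] [Finite F] (n : ℕ) (h : F[X]) (hh : h ∈ scMon F n) :
    n = ∑ P ∈ scIrr F n, ∑ e ∈ Finset.Icc 1 n, if P ^ e ∣ h then P.natDegree else 0 := by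
  obtain ⟨hm, hn⟩ := sc_mem_mon.1 hh
  have hne : h ≠ 0 := hm.ne_zero
  set s := UniqueFactorizationMonoid.normalizedFactors h with hs
  have hprod : s.prod = h := by
    have := UniqueFactorizationMonoid.prod_normalizedFactors_eq hne
    rw [this, hm.normalize_eq_self]
  have hmon : ∀ P ∈ s, P.Monic := by
    intro P hP
    have h1 := UniqueFactorizationMonoid.irreducible_of_normalized_factor P hP
    have h2 := UniqueFactorizationMonoid.normalize_normalized_factor P hP
    rw [← h2]
    exact Polynomial.monic_normalize h1.ne_zero
  have hirr : ∀ P ∈ s, Irreducible P :=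
    UniqueFactorizationMonoid.irreducible_of_normalized_factor
  have hdvd : ∀ P ∈ s, P ∣ h := fun P hP =>
    UniqueFactorizationMonoid.dvd_of_mem_normalizedFactors hP
  have hsub : s.toFinset ⊆ scIrr F n := by
    intro P hP
    rw [Multiset.mem_toFinset] at hP
    exact sc_mem_irr.2 ⟨hmon P hP, hn ▸ natDegree_le_of_dvd (hdvd P hP) hne, hirr P hP⟩
  have hdeg : n = ∑ P ∈ s.toFinset, s.count P * P.natDegree := by
    have h1 : h.natDegree = (s.map natDegree).sum := by
      conv_lhs => rw [← hprod]
      exact natDegree_multiset_prod_of_monic s hmon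
    rw [← hn, h1, Finset.sum_multiset_map_count]
    simp
  have hdeg2 : n = ∑ P ∈ scIrr F n, s.count P * P.natDegree := by
    conv_lhs => rw [hdeg]
    refine Finset.sum_subset hsub fun P _ hP => ?_
    rw [Multiset.mem_toFinset] at hP
    rw [Multiset.count_eq_zero_of_notMem hP, zero_mul]
  conv_lhs => rw [hdeg2]
  refine Finset.sum_congr rfl fun P hP => ?_
  obtain ⟨hPm, hPd, hPi⟩ := sc_mem_irr.1 hP
  have hpow : ∀ e, P ^ e ∣ h ↔ e ≤ s.count P := by
    intro e
    rw [pow_dvd_iff_le_emultiplicity,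
      UniqueFactorizationMonoid.emultiplicity_eq_count_normalizedFactors hPi hne,
      hPm.normalize_eq_self]
    exact Nat.cast_le
  have hcle : s.count P ≤ n := by
    have h1 := natDegree_le_of_dvd ((hpow (s.count P)).2 le_rfl) hne
    rw [natDegree_pow, hn] at h1
    have := hPi.natDegree_pos
    nlinarith
  simp_rw [hpow]
  rw [← Finset.sum_filter, Finset.sum_const, smul_eq_mul]
  congr 1
  have : Finset.filter (fun e => e ≤ s.count P) (Finset.Icc 1 n) = Finset.Icc 1 (s.count P) := by
    ext e; simp only [Finset.mem_filter, Finset.mem_Icc]; omega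
  rw [this]; simp

open Polynomial Classical in
lemma sc_inner {F : Type*} [Field F] [Finite F] (ψ : F[X] → ℂ)
    (hmul : ∀ a b : F[X], a.Monic → b.Monic → ψ (a * b) = ψ a * ψ b)
    (n : ℕ) (R : F[X]) (hR : R.Monic) :
    ∑ h ∈ scMon F n, (if R ∣ h then ψ h else 0) =
      if R.natDegree ≤ n then ψ R * ∑ h ∈ scMon F (n - R.natDegree), ψ h else 0 := by
  split_ifs with hle
  · rw [← Finset.sum_filter, Finset.mul_sum]
    symm
    refine Finset.sum_bij (fun h _ => R * h) ?_ ?_ ?_ ?_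
    · intro h hh
      obtain ⟨hm, hd⟩ := sc_mem_mon.1 hh
      rw [Finset.mem_filter, sc_mem_mon]
      refine ⟨⟨hR.mul hm, ?_⟩, Dvd.intro _ rfl⟩
      rw [hR.natDegree_mul hm, hd]; omega
    · intro a _ b _ hab
      exact mul_left_cancel₀ hR.ne_zero hab
    · intro b hb
      rw [Finset.mem_filter, sc_mem_mon] at hb
      obtain ⟨⟨hm, hd⟩, ⟨a, rfl⟩⟩ := hb
      have ha : a.Monic := hR.of_mul_monic_left hm
      refine ⟨a, sc_mem_mon.2 ⟨ha, ?_⟩, rfl⟩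
      rw [hR.natDegree_mul ha] at hd; omega
    · intro a ha
      exact (hmul R a hR (sc_mem_mon.1 ha).1).symm
  · refine Finset.sum_eq_zero fun h hh => ?_
    rw [if_neg]
    intro hd
    obtain ⟨hm, hd'⟩ := sc_mem_mon.1 hh
    have := natDegree_le_of_dvd hd hm.ne_zero
    omega

open Polynomial Classical in
lemma sc_recursion {F : Type*} [Field F] [Finite F] (ψ : F[X] → ℂ) (hone : ψ 1 = 1)
    (hmul : ∀ a b : F[X], a.Monic → b.Monic → ψ (a * b) = ψ a * ψ b)
    (S : ℕ → ℂ)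
    (hS : ∀ n k, 1 ≤ k → k ≤ n → S k = ∑ P ∈ scIrr F n, ∑ e ∈ Finset.Icc 1 n,
      if e * P.natDegree = k then (P.natDegree : ℂ) * ψ P ^ e else 0)
    (n : ℕ) :
    (n : ℂ) * ∑ h ∈ scMon F n, ψ h =
      ∑ k ∈ Finset.Icc 1 n, S k * ∑ h ∈ scMon F (n - k), ψ h := by
  have hpow : ∀ P : F[X], P.Monic → ∀ e, ψ (P ^ e) = ψ P ^ e := by
    intro P hP e
    induction e with
    | zero => simp [hone]
    | succ e ih => rw [pow_succ, hmul _ _ (hP.pow e) hP, ih, pow_succ]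
  have h1 : (n : ℂ) * ∑ h ∈ scMon F n, ψ h = ∑ h ∈ scMon F n, ∑ P ∈ scIrr F n,
      ∑ e ∈ Finset.Icc 1 n, (P.natDegree : ℂ) * if P ^ e ∣ h then ψ h else 0 := by
    rw [Finset.mul_sum]
    refine Finset.sum_congr rfl fun h hh => ?_
    have := congrArg (Nat.cast : ℕ → ℂ) (sc_degree_eq n h hh)
    conv_lhs => rw [this]
    push_cast
    simp_rw [Finset.sum_mul]
    refine Finset.sum_congr rfl fun P _ => Finset.sum_congr rfl fun e _ => ?_
    split_ifs <;> simp
  rw [h1, Finset.sum_comm]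
  have h2 : ∑ k ∈ Finset.Icc 1 n, S k * ∑ h ∈ scMon F (n - k), ψ h =
      ∑ k ∈ Finset.Icc 1 n, ∑ P ∈ scIrr F n, ∑ e ∈ Finset.Icc 1 n,
        (if e * P.natDegree = k then (P.natDegree : ℂ) * ψ P ^ e else 0) *
          ∑ h ∈ scMon F (n - k), ψ h := by
    refine Finset.sum_congr rfl fun k hk => ?_
    rw [Finset.mem_Icc] at hk
    rw [hS n k hk.1 hk.2, Finset.sum_mul]
    simp_rw [Finset.sum_mul]
  rw [h2]
  refine Eq.trans ?_ Finset.sum_comm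
  refine Finset.sum_congr rfl fun P hP => ?_
  obtain ⟨hPm, hPd, hPi⟩ := sc_mem_irr.1 hP
  refine Eq.trans Finset.sum_comm (Eq.trans ?_ Finset.sum_comm)
  refine Finset.sum_congr rfl fun e he => ?_
  rw [Finset.mem_Icc] at he
  rw [← Finset.mul_sum, sc_inner ψ hmul n (P ^ e) (hPm.pow e), hpow P hPm, natDegree_pow]
  have hpos : 1 ≤ e * P.natDegree := Nat.mul_pos he.1 hPi.natDegree_pos
  simp_rw [ite_mul, zero_mul]
  rw [Finset.sum_ite_eq]
  simp only [Finset.mem_Icc, hpos, true_and]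
  split_ifs <;> ring


open Polynomial in
lemma sc_norm_pb {K S : Type*} [Field K] [Field S] [Algebra K S] [FiniteDimensional K S]
    [Algebra.IsSeparable K S] (pb : PowerBasis K S) (g : K[X]) :
    Algebra.norm K (aeval pb.gen g) = resultant (minpoly K pb.gen) g := by
  let Ω := AlgebraicClosure K
  have hfx : IsSeparable K pb.gen := Algebra.IsSeparable.isSeparable K _
  have hint : IsIntegral K pb.gen := Algebra.IsSeparable.isIntegral K _
  apply (algebraMap K Ω).injective
  rw [Algebra.norm_eq_prod_embeddings, ← resultant_map_map]
  have h1 := resultant_eq_prod_eval ((minpoly K pb.gen).map (algebraMap K Ω))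
    (g.map (algebraMap K Ω)) g.natDegree natDegree_map_le (IsAlgClosed.splits _)
  rw [natDegree_map] at h1
  rw [h1, ((minpoly.monic hint).map _).leadingCoeff, one_pow, one_mul]
  classical
  rw [Fintype.prod_equiv pb.liftEquiv' (fun σ : S →ₐ[K] Ω => σ (aeval pb.gen g))
    (fun y => aeval (y : Ω) g)]
  · rw [Finset.prod_mem_multiset _ _ (fun y : Ω => aeval y g) (fun _ => rfl),
      Finset.prod_eq_multiset_prod, Multiset.toFinset_val,
      Multiset.dedup_eq_self.mpr]
    · congr 2
      ext y
      rw [eval_map_algebraMap]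
    · exact nodup_roots (.map hfx)
  · intro σ
    rw [PowerBasis.liftEquiv'_apply_coe, aeval_algHom_apply]

open Polynomial IntermediateField in
lemma sc_norm_gen {K S : Type*} [Field K] [Field S] [Algebra K S] [FiniteDimensional K S]
    [Algebra.IsSeparable K S] (x : S) (g : K[X]) :
    Algebra.norm K (aeval x g) = resultant (minpoly K x) g ^ Module.finrank K⟮x⟯ S := by
  have hx := Algebra.IsSeparable.isIntegral K x
  have hsep : Algebra.IsSeparable K K⟮x⟯ := Algebra.isSeparable_tower_bot_of_isSeparable K K⟮x⟯ S
  have h1 := sc_norm_pb (adjoin.powerBasis hx) g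
  rw [adjoin.powerBasis_gen hx, minpoly_gen] at h1
  have h2 : aeval x g = algebraMap K⟮x⟯ S (aeval (AdjoinSimple.gen K x) g) := by
    rw [← aeval_algebraMap_apply, AdjoinSimple.algebraMap_gen]
  rw [h2, ← Algebra.norm_norm (S := K⟮x⟯), Algebra.norm_algebraMap, map_pow, h1]

open Polynomial IntermediateField in
lemma sc_norm_gen' {K S : Type*} [Field K] [Field S] [Algebra K S] [FiniteDimensional K S]
    [Algebra.IsSeparable K S] (x : S) (g : K[X]) (e : ℕ)
    (he : e * (minpoly K x).natDegree = Module.finrank K S) :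
    Algebra.norm K (aeval x g) = resultant (minpoly K x) g ^ e := by
  have hx := Algebra.IsSeparable.isIntegral K x
  rw [sc_norm_gen]
  congr 1
  have h1 := Module.finrank_mul_finrank K K⟮x⟯ S
  rw [adjoin.finrank hx] at h1
  have h3 := minpoly.natDegree_pos hx
  have : (minpoly K x).natDegree * Module.finrank K⟮x⟯ S = (minpoly K x).natDegree * e := by
    rw [h1, ← he]; ring
  exact Nat.eq_of_mul_eq_mul_left h3 this

open Polynomial in
lemma sc_norm_adjoinRoot {K : Type*} [Field K] [PerfectField K] (P : K[X]) (hP : P.Monic)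
    [hi : Fact (Irreducible P)] (g : K[X]) :
    Algebra.norm K (AdjoinRoot.mk P g) = resultant P g := by
  have : FiniteDimensional K (AdjoinRoot P) := (AdjoinRoot.powerBasis hP.ne_zero).finite
  have : Algebra.IsAlgebraic K (AdjoinRoot P) := Algebra.IsAlgebraic.of_finite _ _
  have h := sc_norm_pb (AdjoinRoot.powerBasis hP.ne_zero) g
  rw [AdjoinRoot.powerBasis_gen, AdjoinRoot.minpoly_root hP.ne_zero, hP.leadingCoeff, inv_one,
    C_1, mul_one, AdjoinRoot.aeval_eq] at h
  exact h


open Polynomial Classical in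
lemma sc_fiber_card {F E : Type*} [Field F] [Finite F] [Field E] [Fintype E] [Algebra F E]
    (P : F[X]) (hPm : P.Monic) (hPi : Irreducible P) (hd : P.natDegree ∣ Module.finrank F E) :
    (Finset.univ.filter fun x : E => minpoly F x = P).card = P.natDegree := by
  have hsplit : (P.map (algebraMap F E)).Splits := by
    have h1 := hPi.natDegree_dvd_iff_dvd_X_pow_card_pow_sub_X.1 hd
    have h2 : Nat.card F ^ Module.finrank F E = Fintype.card E := by
      rw [← Module.natCard_eq_pow_finrank, Nat.card_eq_fintype_card]
    rw [h2] at h1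
    have h3 := (FiniteField.isSplittingField_sub E F).splits
    refine Splits.of_dvd h3 ?_ (Polynomial.map_dvd (algebraMap F E) h1)
    refine Polynomial.map_ne_zero ?_
    exact FiniteField.X_pow_card_sub_X_ne_zero F Fintype.one_lt_card
  have hsep : P.Separable := PerfectField.separable_of_irreducible hPi
  rw [← card_rootSet_eq_natDegree hsep hsplit, Fintype.card_subtype]
  congr 1
  ext x
  simp only [Finset.mem_filter, Finset.mem_univ, true_and]
  rw [mem_rootSet]
  constructor
  · rintro rfl
    exact ⟨hPi.ne_zero, minpoly.aeval F x⟩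
  · rintro ⟨_, h⟩
    exact (minpoly.eq_of_irreducible_of_monic hPi h hPm).symm

open Polynomial Classical in
lemma sc_S_formula {F E : Type*} [Field F] [Finite F] [Field E] [Fintype E] [Algebra F E]
    (χ : MulChar F ℂ) (f : F[X]) (n : ℕ) (hk : Module.finrank F E ≤ n) :
    ∑ x : E, χ (Algebra.norm F (aeval x f)) =
      ∑ P ∈ scIrr F n, ∑ e ∈ Finset.Icc 1 n,
        if e * P.natDegree = Module.finrank F E then
          (P.natDegree : ℂ) * χ (resultant P f) ^ e else 0 := by
  have hfin : FiniteDimensional F E := Module.Finite.of_finite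
  have hmin : ∀ x : E, minpoly F x ∈ scIrr F n := by
    intro x
    have hx : IsIntegral F x := Algebra.IsIntegral.isIntegral x
    exact sc_mem_irr.2 ⟨minpoly.monic hx, (minpoly.natDegree_le x).trans hk, minpoly.irreducible hx⟩
  rw [← Finset.sum_fiberwise_of_maps_to (s := Finset.univ) (t := scIrr F n)
    (g := fun x : E => minpoly F x) (fun x _ => hmin x)]
  refine Finset.sum_congr rfl fun P hP => ?_
  obtain ⟨hPm, hPd, hPi⟩ := sc_mem_irr.1 hP
  have hpos := hPi.natDegree_pos
  by_cases hd : P.natDegree ∣ Module.finrank F E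
  · obtain ⟨e, he⟩ := hd
    have hkpos : 0 < Module.finrank F E := Module.finrank_pos
    rw [Finset.sum_eq_single_of_mem e, if_pos (by rw [he, mul_comm])]
    · rw [← sc_fiber_card (E := E) P hPm hPi ⟨e, he⟩, ← nsmul_eq_mul]
      refine Finset.sum_eq_card_nsmul fun x hx => ?_
      have hx' : minpoly F x = P := (Finset.mem_filter.1 hx).2
      rw [sc_norm_gen' x f e (by rw [hx', he, mul_comm]), hx', map_pow,
        sc_fiber_card P hPm hPi ⟨e, he⟩]
    · rw [Finset.mem_Icc]
      constructor
      · rcases Nat.eq_zero_or_pos e with h | h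
        · subst h; omega
        · exact h
      · calc e ≤ P.natDegree * e := Nat.le_mul_of_pos_left _ hpos
          _ ≤ n := by rw [← he]; exact hk
    · intro b _ hb
      rw [if_neg]
      intro h
      apply hb
      rw [he, mul_comm] at h
      exact Nat.eq_of_mul_eq_mul_left hpos h
  · rw [Finset.sum_eq_zero, Finset.sum_eq_zero]
    · intro e _
      rw [if_neg]
      intro h
      exact hd ⟨e, by rw [← h, mul_comm]⟩
    · intro x hx
      exfalso
      have hx' : minpoly F x = P := (Finset.mem_filter.1 hx).2
      apply hd
      rw [← hx']
      exact minpoly.degree_dvd (Algebra.IsIntegral.isIntegral x)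


open Polynomial in
lemma sc_vanish_aux {F : Type*} [Field F] [Finite F] (θ : F[X] → ℂ) (m h0 h1 c : F[X])
    (hm : m.Monic)
    (h01 : h0 * h1 + c * m = 1) (hmul : ∀ a b, θ (a * b) = θ a * θ b)
    (hmod : ∀ a b, m ∣ a - b → θ a = θ b) (hne : θ h0 ≠ 1) (n : ℕ) (hn : m.natDegree ≤ n) :
    ∑ h ∈ scMon F n, θ h = 0 := by
  classical
  let σ : F[X] → F[X] := fun h => h + ((h0 * h - h) %ₘ m)
  have hσmod : ∀ h, m ∣ σ h - h0 * h := by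
    intro h
    refine ⟨-((h0 * h - h) /ₘ m), ?_⟩
    have := modByMonic_add_div (h0 * h - h) m
    simp only [σ]
    linear_combination this
  have hmaps : ∀ h ∈ scMon F n, σ h ∈ scMon F n := by
    intro h hh
    obtain ⟨h1, h2⟩ := sc_mem_mon.1 hh
    have hdeg : ((h0 * h - h) %ₘ m).degree < h.degree := by
      refine (degree_modByMonic_lt _ hm).trans_le ?_
      rw [degree_eq_natDegree hm.ne_zero, degree_eq_natDegree h1.ne_zero, h2]
      exact_mod_cast hn
    rw [sc_mem_mon]
    exact ⟨h1.add_of_left hdeg, by rw [natDegree_add_eq_left_of_degree_lt hdeg, h2]⟩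
  have hinj : Set.InjOn σ (scMon F n) := by
    intro a _ b _ hab
    have e1 : m ∣ h0 * (a - b) := by
      have := dvd_sub (hσmod b) (hσmod a)
      rw [hab] at this
      convert this using 1
      ring
    have e2 : m ∣ a - b := by
      have : IsCoprime m h0 := ⟨c, h1, by linear_combination h01⟩
      exact this.dvd_of_dvd_mul_left e1
    have e3 : (h0 * a - a) %ₘ m = (h0 * b - b) %ₘ m := by
      rw [← sub_eq_zero, ← sub_modByMonic, modByMonic_eq_zero_iff_dvd hm]
      have : h0 * a - a - (h0 * b - b) = (h0 - 1) * (a - b) := by ring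
      rw [this]
      exact e2.mul_left _
    simp only [σ, e3] at hab
    exact add_right_cancel hab
  have himg : (scMon F n).image σ = scMon F n := by
    refine Finset.eq_of_subset_of_card_le (Finset.image_subset_iff.2 hmaps) ?_
    rw [Finset.card_image_of_injOn hinj]
  have hsum : ∑ h ∈ scMon F n, θ h = θ h0 * ∑ h ∈ scMon F n, θ h := by
    conv_lhs => rw [← himg, Finset.sum_image hinj]
    rw [Finset.mul_sum]
    refine Finset.sum_congr rfl fun h _ => ?_
    rw [hmod _ _ (hσmod h), hmul]
  have : (1 - θ h0) * ∑ h ∈ scMon F n, θ h = 0 := by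
    rw [sub_mul, one_mul, sub_eq_zero]; exact hsum
  rcases mul_eq_zero.1 this with h | h
  · exact absurd (sub_eq_zero.1 h).symm hne
  · exact h

open Polynomial in
lemma sc_vanish {F : Type*} [Field F] [Finite F] {L : ℕ} (χ : MulChar F ℂ)
    (p : Fin L → F[X]) (hmon : ∀ i, (p i).Monic) (hirr : ∀ i, Irreducible (p i))
    (hdist : Function.Injective p) (u : Fin L → ℕ) (i₀ : Fin L) (a : F) (ha : a ≠ 0)
    (hχa : χ a ^ u i₀ ≠ 1) (n : ℕ) (hn : ∑ i, (p i).natDegree ≤ n) :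
    ∑ h ∈ scMon F n, χ (resultant h (∏ i, p i ^ u i)) = 0 := by
  classical
  have hfact : ∀ i, Fact (Irreducible (p i)) := fun i => ⟨hirr i⟩
  let θ : F[X] → ℂ := fun h => ∏ i, χ (Algebra.norm F (AdjoinRoot.mk (p i) h)) ^ u i
  have hres : ∀ h : F[X], resultant (∏ i, p i ^ u i) h =
      ∏ i, (Algebra.norm F (AdjoinRoot.mk (p i) h)) ^ u i := by
    intro h
    rw [resultant_prod_left _ _ _ _ _ le_rfl]
    · refine Finset.prod_congr rfl fun i _ => ?_
      rw [resultant_pow_left _ _ _ _ _ le_rfl, sc_norm_adjoinRoot (p i) (hmon i)]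
      rw [(hmon i).leadingCoeff]; simp
    · simp [((hmon _).pow _).leadingCoeff]
  have hψ : ∀ h ∈ scMon F n, χ (resultant h (∏ i, p i ^ u i)) =
      χ ((-1) ^ (n * (∏ i, p i ^ u i).natDegree)) * θ h := by
    intro h hh
    obtain ⟨h1, h2⟩ := sc_mem_mon.1 hh
    rw [resultant_comm, hres, map_mul, map_prod, h2]
    simp_rw [map_pow]
    rfl
  rw [Finset.sum_congr rfl hψ, ← Finset.mul_sum]
  have hcop : ∀ i j, i ≠ j → IsCoprime (p i) (p j) := by
    intro i j hij
    rw [(hirr i).coprime_iff_not_dvd]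
    intro hd
    apply hij
    apply hdist
    exact eq_of_monic_of_associated (hmon i) (hmon j) ((hirr i).associated_of_dvd (hirr j) hd)
  have hfd : FiniteDimensional F (AdjoinRoot (p i₀)) :=
    (AdjoinRoot.powerBasis (hmon i₀).ne_zero).finite
  have hfin : Finite (AdjoinRoot (p i₀)) := Module.finite_of_finite F
  obtain ⟨y, hy⟩ := FiniteField.norm_surjective F (AdjoinRoot (p i₀)) a
  obtain ⟨g, rfl⟩ := AdjoinRoot.mk_surjective y
  have hcop2 : IsCoprime (p i₀) (∏ j ∈ Finset.univ.erase i₀, p j) :=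
    IsCoprime.prod_right fun j hj => hcop _ _ (Finset.ne_of_mem_erase hj).symm
  obtain ⟨b1, b2, hb⟩ := hcop2
  set m' := ∏ j ∈ Finset.univ.erase i₀, p j with hm'
  let h0 := g * (b2 * m') + b1 * p i₀
  have hmk0 : AdjoinRoot.mk (p i₀) h0 = AdjoinRoot.mk (p i₀) g := by
    rw [AdjoinRoot.mk_eq_mk]
    refine ⟨b1 - g * b1, ?_⟩
    simp only [h0]
    linear_combination g * hb
  have hmkj : ∀ j, j ≠ i₀ → AdjoinRoot.mk (p j) h0 = 1 := by
    intro j hj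
    rw [← map_one (AdjoinRoot.mk (p j)), AdjoinRoot.mk_eq_mk]
    have : p j ∣ m' := Finset.dvd_prod_of_mem _ (Finset.mem_erase.2 ⟨hj, Finset.mem_univ _⟩)
    have e : h0 - 1 = (g - 1) * b2 * m' := by
      simp only [h0]; linear_combination hb
    rw [e]
    exact this.mul_left _
  have hθ0 : θ h0 = χ a ^ u i₀ := by
    simp only [θ]
    rw [Finset.prod_eq_single i₀]
    · rw [hmk0, hy]
    · intro j _ hj
      rw [hmkj j hj]; simp
    · simp
  have hmm : (∏ i, p i).Monic := monic_prod_of_monic _ _ fun i _ => hmon i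
  have hcop0 : IsCoprime h0 (∏ i, p i) := by
    refine IsCoprime.prod_right fun j _ => ?_
    rw [isCoprime_comm, (hirr j).coprime_iff_not_dvd, ← AdjoinRoot.mk_eq_zero]
    by_cases hj : j = i₀
    · subst hj
      rw [hmk0]
      intro h
      rw [h, Algebra.norm_zero] at hy
      exact ha hy.symm
    · rw [hmkj j hj]; exact one_ne_zero
  obtain ⟨c1, c2, hc⟩ := hcop0
  have hdeg : (∏ i, p i).natDegree = ∑ i, (p i).natDegree :=
    natDegree_prod_of_monic _ _ fun i _ => hmon i
  rw [sc_vanish_aux θ (∏ i, p i) h0 c1 c2 hmm (by linear_combination hc) _ _ _ n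
    (by rw [hdeg]; exact hn), mul_zero]
  · intro x y
    simp only [θ, map_mul, mul_pow, Finset.prod_mul_distrib]
  · intro x y hxy
    simp only [θ]
    refine Finset.prod_congr rfl fun i _ => ?_
    have : AdjoinRoot.mk (p i) x = AdjoinRoot.mk (p i) y := by
      rw [AdjoinRoot.mk_eq_mk]
      exact (Finset.dvd_prod_of_mem _ (Finset.mem_univ i)).trans hxy
    rw [this]
  · rw [hθ0]; exact hχa


open Polynomial in
lemma sc_hnp {F E : Type*} [Field F] [Finite F] [Field E] [Algebra F E] {L : ℕ}
    (p : Fin L → F[X]) (hmon : ∀ i, (p i).Monic) (hirr : ∀ i, Irreducible (p i))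
    (hdist : Function.Injective p) (u : Fin L → ℕ) (r : ℕ) (i₀ : Fin L) (hu : ¬ r ∣ u i₀)
    (c : E) (hc : c ≠ 0) (a b : E[X]) (ha : a ≠ 0) (hb : b ≠ 0) :
    (∏ i, p i ^ u i).map (algebraMap F E) * a ^ r ≠ C c * b ^ r := by
  classical
  intro heq
  have hcop : ∀ i j, i ≠ j → IsCoprime (p i) (p j) := by
    intro i j hij
    rw [(hirr i).coprime_iff_not_dvd]
    intro hd
    apply hij
    apply hdist
    exact eq_of_monic_of_associated (hmon i) (hmon j) ((hirr i).associated_of_dvd (hirr j) hd)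
  have hnu : ¬ IsUnit ((p i₀).map (algebraMap F E)) := by
    intro h
    have := natDegree_eq_zero_of_isUnit h
    rw [natDegree_map] at this
    exact (hirr i₀).natDegree_pos.ne' this
  obtain ⟨π, hπ, hπd⟩ := WfDvdMonoid.exists_irreducible_factor hnu
    (((hmon i₀).map (algebraMap F E)).ne_zero)
  have hprime : Prime π := hπ.prime
  have hsep : ((p i₀).map (algebraMap F E)).Separable :=
    (PerfectField.separable_of_irreducible (hirr i₀)).map
  have hsq := hsep.squarefree
  have m1 : emultiplicity π ((p i₀).map (algebraMap F E)) = 1 := by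
    apply le_antisymm
    · exact (squarefree_iff_emultiplicity_le_one _).1 hsq π |>.resolve_right hπ.not_isUnit
    · rw [← pow_one π] at hπd
      exact_mod_cast le_emultiplicity_of_pow_dvd hπd
  have m2 : ∀ j, j ≠ i₀ → emultiplicity π ((p j).map (algebraMap F E)) = 0 := by
    intro j hj
    rw [emultiplicity_eq_zero]
    intro h
    have h2 : IsCoprime ((p j).map (algebraMap F E)) ((p i₀).map (algebraMap F E)) :=
      (hcop j i₀ hj).map (mapRingHom (algebraMap F E))
    exact hπ.not_isUnit (h2.isUnit_of_dvd' h hπd)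
  have m3 : emultiplicity π ((∏ i, p i ^ u i).map (algebraMap F E)) = u i₀ := by
    rw [Polynomial.map_prod, Finset.emultiplicity_prod hprime, Finset.sum_eq_single i₀]
    · rw [Polynomial.map_pow, emultiplicity_pow hprime, m1, mul_one]
    · intro j _ hj
      rw [Polynomial.map_pow, emultiplicity_pow hprime, m2 j hj, mul_zero]
    · simp
  have hfa : FiniteMultiplicity π a := FiniteMultiplicity.of_prime_left hprime ha
  have hfb : FiniteMultiplicity π b := FiniteMultiplicity.of_prime_left hprime hb
  have m4 := congrArg (emultiplicity π) heq
  have m5 : emultiplicity π (C c) = 0 := by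
    rw [emultiplicity_eq_zero]
    intro h
    exact hπ.not_isUnit (isUnit_of_dvd_unit h (isUnit_C.2 (isUnit_iff_ne_zero.2 hc)))
  rw [emultiplicity_mul hprime, emultiplicity_mul hprime, emultiplicity_pow hprime,
    emultiplicity_pow hprime, m3, m5, zero_add, hfa.emultiplicity_eq_multiplicity,
    hfb.emultiplicity_eq_multiplicity] at m4
  have m6 : u i₀ + r * multiplicity π a = r * multiplicity π b := by exact_mod_cast m4
  apply hu
  have h7 : r ∣ u i₀ + r * multiplicity π a := m6 ▸ Dvd.intro _ rfl
  exact (Nat.dvd_add_left (Dvd.intro _ rfl)).1 h7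


open Polynomial in
lemma sc_analytic (c S : ℕ → ℂ) (s : ℕ) (R Cst : ℝ) (hR : 0 < R) (hC : 0 ≤ Cst)
    (hc0 : c 0 = 1) (hcz : ∀ n, s < n → c n = 0)
    (hrec : ∀ n : ℕ, ((n + 1 : ℕ) : ℂ) * c (n + 1) =
      ∑ k ∈ Finset.range (n + 1), S (k + 1) * c (n - k))
    (hS : ∀ k : ℕ, ‖S (k + 1)‖ ≤ Cst * R ^ (k + 1)) :
    ‖c 1‖ ≤ s * R := by
  set L : ℂ[X] := ∑ n ∈ Finset.range (s + 1), C (c n) * X ^ n with hL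
  have hLcoeff : ∀ n, L.coeff n = c n := by
    intro n
    simp only [hL, finsetSum_coeff, coeff_C_mul_X_pow]
    simp only [Finset.sum_ite_eq, Finset.mem_range]
    split_ifs with h
    · rfl
    · exact (hcz n (by omega)).symm
  have hL0 : L.eval 0 = 1 := by rw [← coeff_zero_eq_eval_zero, hLcoeff, hc0]
  have hLne : L ≠ 0 := by intro h; rw [h] at hL0; simp at hL0
  have hLdeg : L.natDegree ≤ s := by
    rw [natDegree_le_iff_coeff_eq_zero]
    intro n hn
    rw [hLcoeff, hcz n hn]
  have hL' : L.derivative.eval 0 = c 1 := by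
    rw [← coeff_zero_eq_eval_zero, coeff_derivative, hLcoeff]; simp
  -- the functional identity
  have hbd : ∀ u : ℂ, ∀ k : ℕ, ‖S (k + 1) * u ^ k‖ ≤ Cst * R * (R * ‖u‖) ^ k := by
    intro u k
    rw [norm_mul, norm_pow]
    calc _ ≤ Cst * R ^ (k + 1) * ‖u‖ ^ k := by gcongr; exact hS k
      _ = _ := by rw [mul_pow]; ring
  have hsG : ∀ u : ℂ, R * ‖u‖ < 1 → Summable fun k => ‖S (k + 1) * u ^ k‖ := by
    intro u hu
    refine Summable.of_nonneg_of_le (fun _ => norm_nonneg _) (hbd u) ?_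
    exact (summable_geometric_of_lt_one (by positivity) hu).mul_left _
  have hpoly : ∀ (P : ℂ[X]) (u : ℂ), HasSum (fun n => P.coeff n * u ^ n) (P.eval u) := by
    intro P u
    rw [eval_eq_sum, Polynomial.sum]
    refine hasSum_sum_of_ne_finset_zero ?_
    intro n hn
    rw [notMem_support_iff.1 hn, zero_mul]
  have hpolyn : ∀ (P : ℂ[X]) (u : ℂ), Summable (fun n => ‖P.coeff n * u ^ n‖) := by
    intro P u
    refine summable_of_ne_finset_zero (s := P.support) ?_
    intro n hn
    rw [notMem_support_iff.1 hn, zero_mul, norm_zero]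
  set G : ℂ → ℂ := fun u => ∑' k, S (k + 1) * u ^ k with hG
  have hid : ∀ u : ℂ, R * ‖u‖ < 1 → L.derivative.eval u = G u * L.eval u := by
    intro u hu
    rw [← (hpoly L u).tsum_eq, ← (hpoly L.derivative u).tsum_eq, hG]
    simp only
    rw [tsum_mul_tsum_eq_tsum_sum_range_of_summable_norm (hsG u hu) (hpolyn L u)]
    congr 1
    ext n
    rw [coeff_derivative, hLcoeff]
    have := hrec n
    push_cast at this
    rw [mul_comm (c (n + 1)), this, Finset.sum_mul]
    refine Finset.sum_congr rfl fun k hk => ?_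
    rw [Finset.mem_range] at hk
    rw [hLcoeff, show u ^ n = u ^ k * u ^ (n - k) by rw [← pow_add]; congr; omega]
    ring
  have hroot : ∀ a ∈ L.roots, 1 ≤ R * ‖a‖ := by
    intro a ha
    by_contra! hlt
    have haR : L.IsRoot a := (mem_roots hLne).1 ha
    set k := L.rootMultiplicity a with hk
    have hkpos : 0 < k := (rootMultiplicity_pos hLne).2 haR
    obtain ⟨P, hP⟩ := pow_rootMultiplicity_dvd L a
    rw [← hk] at hP
    have hPa : P.eval a ≠ 0 := by
      intro h
      rw [← IsRoot.def, ← dvd_iff_isRoot] at h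
      have h2 : (X - C a) ^ (k + 1) ∣ L := by
        rw [pow_succ, hP]; exact mul_dvd_mul_left _ h
      have := (le_rootMultiplicity_iff hLne).2 h2
      omega
    obtain ⟨m, hm⟩ : ∃ m, k = m + 1 := ⟨k - 1, by omega⟩
    have hid2 : ∀ u : ℂ, R * ‖u‖ < 1 → u ≠ a →
        (m + 1 : ℂ) * P.eval u + (u - a) * P.derivative.eval u = G u * ((u - a) * P.eval u) := by
      intro u hu hua
      have h1 := hid u hu
      rw [hP, hm] at h1
      have h3 : (u - a) ^ m ≠ 0 := pow_ne_zero _ (sub_ne_zero.2 hua)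
      apply mul_left_cancel₀ h3
      simp only [derivative_mul, derivative_X_sub_C_pow, eval_mul, eval_add, eval_pow, eval_sub,
        eval_X, eval_C, Nat.add_sub_cancel] at h1
      push_cast at h1
      linear_combination h1
    -- take limits
    obtain ⟨ρ, hρ1, hρ2⟩ := exists_between hlt
    have hev : ∀ᶠ u in nhdsWithin a {a}ᶜ, R * ‖u‖ < ρ ∧ u ≠ a := by
      refine Filter.Eventually.and ?_ self_mem_nhdsWithin
      apply Filter.Eventually.filter_mono nhdsWithin_le_nhds
      have : Continuous fun u : ℂ => R * ‖u‖ := by fun_prop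
      exact this.continuousAt.eventually_lt continuousAt_const hρ1
    have hρ0 : 0 ≤ ρ := le_trans (by positivity) hρ1.le
    have hGb : ∀ u : ℂ, R * ‖u‖ < ρ → ‖G u‖ ≤ Cst * R * (1 - ρ)⁻¹ := by
      intro u hu
      refine tsum_of_norm_bounded ((hasSum_geometric_of_lt_one hρ0 hρ2).mul_left (Cst * R)) ?_
      intro i
      refine (hbd u i).trans ?_
      gcongr
    have ht1 : Filter.Tendsto (fun u : ℂ => (m + 1 : ℂ) * P.eval u + (u - a) * P.derivative.eval u)
        (nhdsWithin a {a}ᶜ) (nhds ((m + 1 : ℂ) * P.eval a)) := by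
      have : Continuous fun u : ℂ => (m + 1 : ℂ) * P.eval u + (u - a) * P.derivative.eval u := by
        fun_prop
      have h2 := (this.tendsto a).mono_left (nhdsWithin_le_nhds (s := {a}ᶜ))
      simpa using h2
    have ht2 : Filter.Tendsto (fun u : ℂ => G u * ((u - a) * P.eval u))
        (nhdsWithin a {a}ᶜ) (nhds 0) := by
      have h3 : Filter.Tendsto (fun u : ℂ => (u - a) * P.eval u) (nhdsWithin a {a}ᶜ) (nhds 0) := by
        have : Continuous fun u : ℂ => (u - a) * P.eval u := by fun_prop
        have h2 := (this.tendsto a).mono_left (nhdsWithin_le_nhds (s := {a}ᶜ))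
        simpa using h2
      have h4 := h3.norm.const_mul (Cst * R * (1 - ρ)⁻¹)
      rw [norm_zero, mul_zero] at h4
      refine squeeze_zero_norm' ?_ h4
      filter_upwards [hev] with u hu
      rw [norm_mul]
      exact mul_le_mul_of_nonneg_right (hGb u hu.1) (norm_nonneg _)
    have ht3 := ht1.congr' (f₂ := fun u : ℂ => G u * ((u - a) * P.eval u)) (by
      filter_upwards [hev] with u hu using hid2 u (hu.1.trans hρ2) hu.2)
    have := tendsto_nhds_unique ht3 ht2
    have hm1 : (m + 1 : ℂ) ≠ 0 := by exact_mod_cast Nat.succ_ne_zero m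
    exact (mul_ne_zero hm1 hPa) this
  have hsplit : L.Splits := IsAlgClosed.splits L
  have hfin : c 1 = (L.roots.map fun z => 1 / (0 - z)).sum := by
    have := hsplit.eval_derivative_div_eval_of_ne_zero (x := 0) (by rw [hL0]; simp)
    rw [hL0, hL', div_one] at this
    exact this
  rw [hfin]
  have hcard : (L.roots.card : ℝ) ≤ s := by exact_mod_cast (card_roots' L).trans hLdeg
  have h1 : ‖(L.roots.map fun z => 1 / (0 - z)).sum‖ ≤ ((L.roots.map fun z => 1 / (0 - z)).map
    (fun z => ‖z‖)).sum := norm_multiset_sum_le _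
  refine h1.trans ?_
  rw [Multiset.map_map]
  refine (Multiset.sum_le_card_nsmul _ R ?_).trans ?_
  · intro x hx
    obtain ⟨a, ha, rfl⟩ := Multiset.mem_map.1 hx
    have h2 := hroot a ha
    have h3 : 0 < ‖a‖ := by
      by_contra h
      have : ‖a‖ = 0 := le_antisymm (not_lt.1 h) (norm_nonneg _)
      rw [this] at h2; linarith [mul_zero R]
    simp only [Function.comp_apply, zero_sub, norm_div, norm_one, norm_neg]
    rw [div_le_iff₀ h3]; exact h2
  · rw [Multiset.card_map, nsmul_eq_mul]
    gcongr


open Polynomial in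
lemma sc_ext_bound {F E : Type*} [Field F] [Finite F] [Field E] [Fintype E] [Algebra F E] {L : ℕ}
    (χ : MulChar F ℂ) (r : ℕ) (hr : r.Prime) (hχ1 : χ ≠ 1) (hχr : χ ^ r = 1)
    (p : Fin L → F[X]) (hmon : ∀ i, (p i).Monic) (hirr : ∀ i, Irreducible (p i))
    (hdist : Function.Injective p) (u : Fin L → ℕ) (i₀ : Fin L) (hu : ¬ r ∣ u i₀)
    (h0 : (∏ i, p i ^ u i).eval 0 ≠ 0) (D : ℕ) (hD : (∏ i, p i ^ u i).natDegree = D) :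
    ‖∑ x : E, χ (Algebra.norm F (aeval x (∏ i, p i ^ u i)))‖ ≤
      (r * (8 * r * (D + 2)) + D) * Real.sqrt (Fintype.card E) := by
  have hfd : FiniteDimensional F E := Module.Finite.of_finite
  let η : MulChar E ℂ := ⟨χ.toMonoidHom.comp (Algebra.norm F), by
    intro a ha
    have : a = 0 := by
      by_contra h
      exact ha (isUnit_iff_ne_zero.2 h)
    subst this
    show χ (Algebra.norm F (0 : E)) = 0
    rw [Algebra.norm_zero, MulChar.map_zero]⟩
  have hηa : ∀ x, η x = χ (Algebra.norm F x) := fun x => rfl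
  have hη1 : η ≠ 1 := by
    intro h
    apply hχ1
    ext a
    obtain ⟨y, hy⟩ := FiniteField.norm_surjective F E (a : F)
    have hy0 : y ≠ 0 := by
      rintro rfl
      rw [Algebra.norm_zero] at hy
      exact a.ne_zero hy.symm
    have h2 : η y = 1 := by
      rw [h, MulChar.one_apply (isUnit_iff_ne_zero.2 hy0)]
    rw [hηa, hy] at h2
    rw [h2, MulChar.one_apply_coe]
  have hηr : η ^ r = 1 := by
    ext a
    rw [MulChar.pow_apply_coe, MulChar.one_apply_coe, hηa]
    have : IsUnit (Algebra.norm F (a : E)) := a.isUnit.map _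
    obtain ⟨b, hb⟩ := this
    rw [← hb, ← MulChar.pow_apply_coe, hχr, MulChar.one_apply_coe]
  have := sc_charsum ((∏ i, p i ^ u i).map (algebraMap F E)) r D hr η hη1 hηr
    (natDegree_map_le.trans hD.le) (by
      rw [← map_zero (algebraMap F E), eval_map_apply, map_zero]
      exact (map_ne_zero (algebraMap F E)).2 h0)
    (fun c hc a b ha hb => sc_hnp p hmon hirr hdist u r i₀ hu c hc a b ha hb)
  simp only [hηa, eval_map_algebraMap] at this
  exact this

open Polynomial in
lemma sc_weil {F : Type*} [Field F] [Fintype F] {L : ℕ}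
    (χ : MulChar F ℂ) (r : ℕ) (hr : r.Prime) (hχ1 : χ ≠ 1) (hχr : χ ^ r = 1)
    (p : Fin L → F[X]) (hmon : ∀ i, (p i).Monic) (hirr : ∀ i, Irreducible (p i))
    (hdist : Function.Injective p) (u : Fin L → ℕ) (i₀ : Fin L) (hu : ¬ r ∣ u i₀)
    (h0 : (∏ i, p i ^ u i).eval 0 ≠ 0) :
    ‖∑ x : F, χ ((∏ i, p i ^ u i).eval x)‖ ≤
      (∑ i, (p i).natDegree : ℕ) * Real.sqrt (Fintype.card F) := by
  classical
  obtain ⟨ℓ, hℓ⟩ := CharP.exists F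
  have hℓp : Fact ℓ.Prime := ⟨CharP.char_is_prime F ℓ⟩
  set f := ∏ i, p i ^ u i with hf
  obtain ⟨a, ha⟩ : ∃ a : Fˣ, χ a ≠ 1 := by
    by_contra h
    push Not at h
    apply hχ1
    ext a
    rw [h, MulChar.one_apply_coe]
  have hχa : χ (a : F) ^ u i₀ ≠ 1 := by
    intro h
    have h2 : χ (a : F) ^ r = 1 := by
      rw [← MulChar.pow_apply_coe, hχr, MulChar.one_apply_coe]
    have h3 := orderOf_dvd_of_pow_eq_one h
    have h4 := orderOf_dvd_of_pow_eq_one h2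
    rcases (Nat.dvd_prime hr).1 h4 with h5 | h5
    · exact ha (orderOf_eq_one_iff.1 h5)
    · exact hu (h5 ▸ h3)
  let c : ℕ → ℂ := fun n => ∑ h ∈ scMon F n, χ (resultant h f)
  let S : ℕ → ℂ := fun k => if hk : k = 0 then 0 else
    haveI : NeZero k := ⟨hk⟩
    letI : Fintype (FiniteField.Extension F ℓ k) := Fintype.ofFinite _
    ∑ x : FiniteField.Extension F ℓ k, χ (Algebra.norm F (aeval x f))
  have hc0 : c 0 = 1 := by
    have : scMon F 0 = {1} := by
      ext h
      rw [sc_mem_mon, Finset.mem_singleton]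
      constructor
      · rintro ⟨h1, h2⟩
        exact h1.natDegree_eq_zero.1 h2
      · rintro rfl
        exact ⟨monic_one, natDegree_one⟩
    simp only [c]
    rw [this, Finset.sum_singleton, natDegree_one, resultant_one_left]
    simp
  have hc1 : c 1 = ∑ x : F, χ (f.eval x) := by
    have : scMon F 1 = Finset.univ.image (fun a : F => X - C a) := by
      ext h
      rw [sc_mem_mon, Finset.mem_image]
      constructor
      · rintro ⟨h1, h2⟩
        refine ⟨-h.coeff 0, Finset.mem_univ _, ?_⟩
        conv_rhs => rw [h1.as_sum, h2]
        simp
      · rintro ⟨a, _, rfl⟩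
        exact ⟨monic_X_sub_C a, natDegree_X_sub_C a⟩
    simp only [c]
    rw [this, Finset.sum_image]
    · refine Finset.sum_congr rfl fun a _ => ?_
      rw [natDegree_X_sub_C, resultant_X_sub_C_left _ _ _ le_rfl]
    · intro x _ y _ hxy
      have h2 : C x = C y := sub_right_injective hxy
      exact C_injective h2
  have hcz : ∀ n, (∑ i, (p i).natDegree) < n → c n = 0 := by
    intro n hn
    exact sc_vanish χ p hmon hirr hdist u i₀ a a.ne_zero hχa n hn.le
  have hrec0 := sc_recursion (F := F) (fun h => χ (resultant h f)) (by
      show χ (resultant 1 f) = 1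
      rw [natDegree_one, resultant_one_left]; simp) (by
      intro a b ha hb
      show χ (resultant (a * b) f) = χ (resultant a f) * χ (resultant b f)
      rw [ha.natDegree_mul hb, resultant_mul_left _ _ _ _ le_rfl, map_mul]) S (by
      intro n k hk hkn
      have hk0 : k ≠ 0 := by omega
      have : NeZero k := ⟨hk0⟩
      let _ : Fintype (FiniteField.Extension F ℓ k) := Fintype.ofFinite _
      have h1 := sc_S_formula (E := FiniteField.Extension F ℓ k) χ f n
        (by rw [FiniteField.finrank_extension]; exact hkn)
      rw [FiniteField.finrank_extension] at h1
      simp only [S]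
      rw [dif_neg hk0]
      exact h1)
  have hrec : ∀ n, ((n + 1 : ℕ) : ℂ) * c (n + 1) =
      ∑ k ∈ Finset.range (n + 1), S (k + 1) * c (n - k) := by
    intro n
    rw [show c (n + 1) = ∑ h ∈ scMon F (n + 1), χ (resultant h f) from rfl, hrec0 (n + 1)]
    refine (Finset.sum_nbij' (fun k => k + 1) (fun k => k - 1) ?_ ?_ ?_ ?_ ?_).symm
    · intro k hk
      rw [Finset.mem_range] at hk
      rw [Finset.mem_Icc]
      omega
    · intro k hk
      rw [Finset.mem_Icc] at hk
      rw [Finset.mem_range]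
      omega
    · intro k _
      simp
    · intro k hk
      rw [Finset.mem_Icc] at hk
      show k - 1 + 1 = k
      omega
    · intro k hk
      show S (k + 1) * c (n - k) = S (k + 1) * c (n + 1 - (k + 1))
      rw [Nat.add_sub_add_right]
  have hS : ∀ k, ‖S (k + 1)‖ ≤ (r * (8 * r * (f.natDegree + 2)) + f.natDegree : ℝ) *
      Real.sqrt (Fintype.card F) ^ (k + 1) := by
    intro k
    have : NeZero (k + 1) := ⟨k.succ_ne_zero⟩
    let _ : Fintype (FiniteField.Extension F ℓ (k + 1)) := Fintype.ofFinite _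
    have h1 := sc_ext_bound (E := FiniteField.Extension F ℓ (k + 1)) χ r hr hχ1 hχr p hmon hirr
      hdist u i₀ hu h0 f.natDegree rfl
    have h2 : Real.sqrt (Fintype.card (FiniteField.Extension F ℓ (k + 1))) =
        Real.sqrt (Fintype.card F) ^ (k + 1) := by
      rw [← Nat.card_eq_fintype_card, FiniteField.natCard_extension, Nat.card_eq_fintype_card,
        Nat.cast_pow]
      rw [Real.sqrt_eq_iff_mul_self_eq (by positivity) (by positivity), ← mul_pow,
        Real.mul_self_sqrt (by positivity)]
    rw [h2] at h1
    simp only [S]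
    rw [dif_neg k.succ_ne_zero]
    exact h1
  rw [← hc1]
  exact sc_analytic c S _ _ _ (Real.sqrt_pos.2 (by exact_mod_cast Fintype.card_pos)) (by positivity)
    hc0 hcz hrec hS

/-- If `deg pᵢ < (q(r-1)-1)/(rL√q)` for all `i`, then the shadow-code
evaluation map is injective, and the dimension of the shadow code is `L`. -/
theorem shadow_code_dimension
    (r q L : ℕ) (hr : r.Prime) (F : Type) [Field F] [Fintype F]
    (hq : Fintype.card F = q)
    (hpp : ∃ p k : ℕ, p.Prime ∧ 0 < k ∧ q = p ^ k) (hdvd : r ∣ q - 1)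
    (χ : Fˣ →* (rootsOfUnity r ℂ)) (hχord : orderOf χ = r)
    (φ : (rootsOfUnity r ℂ) → ZMod r)
    (hφbij : Function.Bijective φ)
    (hφadd : ∀ a b : (rootsOfUnity r ℂ), φ (a * b) = φ a + φ b)
    (p : Fin L → Polynomial F) (hmon : ∀ i, (p i).Monic)
    (hirr : ∀ i, Irreducible (p i)) (hdist : Function.Injective p)
    (hdeg : ∀ i, 2 ≤ (p i).natDegree)
    (hnz : ∀ i (x : F), (p i).eval x ≠ 0)
    (hsmall : ∀ i, ((p i).natDegree : ℝ)
        < ((q : ℝ) * ((r : ℝ) - 1) - 1) / ((r : ℝ) * L * Real.sqrt q)) :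
    Function.Injective (shadowEv χ φ p hnz)
    ∧ Module.finrank (ZMod r)
        (Submodule.span (ZMod r) (Set.range (shadowEv χ φ p hnz))) = L := by
  have hrf : Fact r.Prime := ⟨hr⟩
  have hrz : NeZero r := ⟨hr.ne_zero⟩
  have hφ1 : φ 1 = 0 := by
    have := hφadd 1 1
    rw [mul_one] at this
    exact left_eq_add.1 this
  have hφpow : ∀ (a : rootsOfUnity r ℂ) (n : ℕ), φ (a ^ n) = n * φ a := by
    intro a n
    induction n with
    | zero => simp [hφ1]
    | succ n ih => rw [pow_succ, hφadd, ih]; push_cast; ring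
  have hφprod : ∀ (s : Finset (Fin L)) (g : Fin L → rootsOfUnity r ℂ),
      φ (∏ i ∈ s, g i) = ∑ i ∈ s, φ (g i) := by
    intro s g
    classical
    induction s using Finset.induction with
    | empty => simp [hφ1]
    | insert a s has ih => rw [Finset.prod_insert has, Finset.sum_insert has, hφadd, ih]
  let T : (Fin L → ZMod r) →ₗ[ZMod r] (F → ZMod r) :=
    { toFun := fun v x => ∑ i, v i * φ (χ (Units.mk0 ((p i).eval x) (hnz i x)))
      map_add' := by
        intro v w
        ext x
        simp [add_mul, Finset.sum_add_distrib]
      map_smul' := by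
        intro c v
        ext x
        simp [Finset.mul_sum, mul_assoc] }
  have hT : shadowEv χ φ p hnz = T := by
    ext v x
    simp only [shadowEv, T, LinearMap.coe_mk, AddHom.coe_mk]
    rw [map_prod, hφprod]
    refine Finset.sum_congr rfl fun i _ => ?_
    rw [map_pow, hφpow, ZMod.natCast_zmod_val]
  have hinj : Function.Injective T := by
    rw [← LinearMap.ker_eq_bot, LinearMap.ker_eq_bot']
    intro v hv
    by_contra hne
    obtain ⟨i₀, hi₀⟩ := Function.ne_iff.1 hne
    have hu : ¬ r ∣ (v i₀).val := by
      intro h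
      have h1 := Nat.eq_zero_of_dvd_of_lt h (ZMod.val_lt _)
      exact hi₀ ((ZMod.val_eq_zero _).1 h1)
    let χcx : MulChar F ℂ := MulChar.ofUnitHom ((rootsOfUnity r ℂ).subtype.comp χ)
    have hχcx : ∀ a : Fˣ, χcx a = ((χ a : ℂˣ) : ℂ) := fun a => MulChar.ofUnitHom_coe _ a
    have hχne : χ ≠ 1 := by
      rintro rfl
      rw [orderOf_one] at hχord
      exact hr.one_lt.ne hχord
    have hχ1 : χcx ≠ 1 := by
      intro h
      apply hχne
      ext a
      rw [← hχcx, h, MulChar.one_apply_coe]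
      simp
    have hχr : χcx ^ r = 1 := by
      ext a
      rw [MulChar.pow_apply_coe, MulChar.one_apply_coe, hχcx]
      have := (χ a).2
      rw [mem_rootsOfUnity] at this
      rw [← Units.val_pow_eq_pow_val, this, Units.val_one]
    have hval : ∀ x : F, χcx ((∏ i, p i ^ (v i).val).eval x) = 1 := by
      intro x
      have h1 : φ (χ (∏ i, (Units.mk0 ((p i).eval x) (hnz i x)) ^ (v i).val)) = φ 1 := by
        rw [hφ1]
        have h2 : shadowEv χ φ p hnz v x = 0 := by rw [hT, hv]; rfl
        exact h2
      have h2 := hφbij.1 h1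
      have h3 := hχcx (∏ i, (Units.mk0 ((p i).eval x) (hnz i x)) ^ (v i).val)
      rw [h2] at h3
      rw [Polynomial.eval_prod]
      simp only [Polynomial.eval_pow]
      simpa [Units.coe_prod] using h3
    have h0 : (∏ i, p i ^ (v i).val).eval 0 ≠ 0 := by
      rw [Polynomial.eval_prod, Finset.prod_ne_zero_iff]
      intro i _
      rw [Polynomial.eval_pow]
      exact pow_ne_zero _ (hnz i 0)
    have hw := sc_weil χcx r hr hχ1 hχr p hmon hirr hdist (fun i => (v i).val) i₀ hu h0
    simp only [hval] at hw
    rw [Finset.sum_const, Finset.card_univ, hq, nsmul_eq_mul, mul_one, Complex.norm_natCast] at hw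
    have hqpos : (0 : ℝ) < q := by
      rw [← hq]
      exact_mod_cast Fintype.card_pos
    have hLpos : (0 : ℝ) < L := by
      have : 0 < L := i₀.pos
      exact_mod_cast this
    have hrpos : (0 : ℝ) < r := by exact_mod_cast hr.pos
    have hsq : 0 < Real.sqrt q := Real.sqrt_pos.2 hqpos
    have hmul : Real.sqrt q * Real.sqrt q = q := Real.mul_self_sqrt hqpos.le
    have hs : ((∑ i, (p i).natDegree : ℕ) : ℝ) <
        L * (((q : ℝ) * ((r : ℝ) - 1) - 1) / ((r : ℝ) * L * Real.sqrt q)) := by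
      push_cast
      have := Finset.sum_lt_sum_of_nonempty (s := (Finset.univ : Finset (Fin L)))
        ⟨i₀, Finset.mem_univ _⟩ (fun i _ => hsmall i)
      rw [Finset.sum_const, Finset.card_univ, Fintype.card_fin, nsmul_eq_mul] at this
      exact this
    have hs2 : (L : ℝ) * (((q : ℝ) * ((r : ℝ) - 1) - 1) / ((r : ℝ) * L * Real.sqrt q)) <
        Real.sqrt q := by
      rw [← mul_div_assoc, div_lt_iff₀ (by positivity)]
      have e : Real.sqrt q * ((r : ℝ) * L * Real.sqrt q) = L * (q * r) := by
        linear_combination ((r : ℝ) * L) * hmul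
      rw [e]
      apply mul_lt_mul_of_pos_left _ hLpos
      linarith
    have hlt := mul_lt_mul_of_pos_right (hs.trans hs2) hsq
    rw [hmul] at hlt
    exact absurd hw (not_le.2 hlt)
  rw [hT]
  refine ⟨hinj, ?_⟩
  rw [← LinearMap.coe_range, Submodule.span_eq, LinearMap.finrank_range_of_inj hinj,
    Module.finrank_fin_fun]
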